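/- arXiv:2305.09818 — 2 statements merged into one kernel-verified Lean document; each statement's English description precedes it below -/
import Mathlib

section
/- Let G be a group of F-type. Then every abelian subgroup of G is either cyclic or free abelian of rank 2 (i.e., isomorphic to ℤ × ℤ). -/
open scoped MatrixGroups

namespace FPaper

/-- A (reduced) word in a free group is *cyclically reduced* if its first letter is not the
formal inverse of its last letter. -/
def CyclicallyReduced {α : Type*} [DecidableEq α] (w : FreeGroup α) : Prop :=
  ∀ x y : α × Bool, w.toWord.head? = some x → w.toWord.getLast? = some y →
    x.1 = y.1 → x.2 = y.2

/-- The combinatorial data of a presentation of F-type: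
`⟨a_1, …, a_n ∣ a_1^{e_1} = ⋯ = a_n^{e_n} = U V = 1⟩` with
`U = U(a_1, …, a_p)` and `V = V(a_{p+1}, …, a_n)`. -/
structure FTypeBase where
  n : ℕ
  e : Fin n → ℕ
  p : ℕ
  U : FreeGroup (Fin n)
  V : FreeGroup (Fin n)

namespace FTypeBase

/-- Relators of the full F-type presentation. -/
def rels (D : FTypeBase) : Set (FreeGroup (Fin D.n)) :=
  {w | ∃ i : Fin D.n, w = FreeGroup.of i ^ D.e i} ∪ {D.U * D.V}

/-- Relators presenting the first factor `G₁` (the generators `a_{p+1}, …, a_n` are killed), so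
that `PresentedGroup D.rels1` is the free product of cyclics on `a_1, …, a_p`. -/
def rels1 (D : FTypeBase) : Set (FreeGroup (Fin D.n)) :=
  {w | ∃ i : Fin D.n, (i : ℕ) < D.p ∧ w = FreeGroup.of i ^ D.e i} ∪
    {w | ∃ i : Fin D.n, D.p ≤ (i : ℕ) ∧ w = FreeGroup.of i}

/-- Relators presenting the second factor `G₂` (the generators `a_1, …, a_p` are killed), so
that `PresentedGroup D.rels2` is the free product of cyclics on `a_{p+1}, …, a_n`. -/
def rels2 (D : FTypeBase) : Set (FreeGroup (Fin D.n)) :=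
  {w | ∃ i : Fin D.n, D.p ≤ (i : ℕ) ∧ w = FreeGroup.of i ^ D.e i} ∪
    {w | ∃ i : Fin D.n, (i : ℕ) < D.p ∧ w = FreeGroup.of i}

/-- The group presented by the F-type presentation. -/
abbrev Gp (D : FTypeBase) := PresentedGroup D.rels

/-- The first factor `G₁ = ⟨a_1, …, a_p ∣ a_1^{e_1} = ⋯ = a_p^{e_p} = 1⟩`. -/
abbrev Gp1 (D : FTypeBase) := PresentedGroup D.rels1

/-- The second factor `G₂ = ⟨a_{p+1}, …, a_n ∣ a_{p+1}^{e_{p+1}} = ⋯ = a_n^{e_n} = 1⟩`. -/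
abbrev Gp2 (D : FTypeBase) := PresentedGroup D.rels2

/-- The image of the word `U` in the first factor `G₁`. -/
def imgU1 (D : FTypeBase) : D.Gp1 := PresentedGroup.mk D.rels1 D.U

/-- The image of the word `V` in the second factor `G₂`. -/
def imgV2 (D : FTypeBase) : D.Gp2 := PresentedGroup.mk D.rels2 D.V

/-- The conditions making an F-type presentation: `n ≥ 2`; each `e_i` is `0` or `≥ 2`;
`1 ≤ p ≤ n - 1`; `U` is a cyclically reduced word in `a_1, …, a_p` of infinite order in `G₁`;
`V` is a cyclically reduced word in `a_{p+1}, …, a_n` of infinite order in `G₂`; and if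
`p = 1` (resp. `p = n - 1`) then `U = a_1^m` (resp. `V = a_n^m`) for some `m ≥ 2`. -/
def IsFType (D : FTypeBase) : Prop :=
  2 ≤ D.n ∧ (∀ i, D.e i = 0 ∨ 2 ≤ D.e i) ∧ 1 ≤ D.p ∧ D.p ≤ D.n - 1 ∧
  (∀ x ∈ D.U.toWord, (x.1 : ℕ) < D.p) ∧ (∀ x ∈ D.V.toWord, D.p ≤ (x.1 : ℕ)) ∧
  CyclicallyReduced D.U ∧ CyclicallyReduced D.V ∧
  ¬ IsOfFinOrder D.imgU1 ∧ ¬ IsOfFinOrder D.imgV2 ∧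
  (D.p = 1 → ∃ (i : Fin D.n) (m : ℕ), (i : ℕ) = 0 ∧ 2 ≤ m ∧ D.U = FreeGroup.of i ^ m) ∧
  (D.p = D.n - 1 → ∃ (i : Fin D.n) (m : ℕ), (i : ℕ) = D.n - 1 ∧ 2 ≤ m ∧ D.V = FreeGroup.of i ^ m)

/-- The subgroup of the F-type group generated by (the images of) `a_1, …, a_p`. -/
def factor1 (D : FTypeBase) : Subgroup D.Gp :=
  Subgroup.closure {g | ∃ i : Fin D.n, (i : ℕ) < D.p ∧ g = PresentedGroup.of i}

/-- The subgroup of the F-type group generated by (the images of) `a_{p+1}, …, a_n`. -/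
def factor2 (D : FTypeBase) : Subgroup D.Gp :=
  Subgroup.closure {g | ∃ i : Fin D.n, D.p ≤ (i : ℕ) ∧ g = PresentedGroup.of i}

/-- The amalgamated subgroup `A = ⟨U⟩ = ⟨V⟩` of the F-type group. -/
def amalg (D : FTypeBase) : Subgroup D.Gp :=
  Subgroup.zpowers (PresentedGroup.mk D.rels D.U)

end FTypeBase

/-- A group is *of F-type* if it is isomorphic to the group of some F-type presentation. -/
def IsFTypeGroup (G : Type*) [Group G] : Prop :=
  ∃ D : FTypeBase, D.IsFType ∧ Nonempty (G ≃* D.Gp)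

/-- An element of a group is a *proper power* if it equals `h ^ k` for some `k ≥ 2`. -/
def IsProperPower {G : Type*} [Group G] (g : G) : Prop :=
  ∃ (h : G) (k : ℕ), 2 ≤ k ∧ g = h ^ k

/-- A group is a *free product of cyclic groups* if it has a presentation in which every
relator is a power of a generator. -/
def IsFreeProductOfCyclics (H : Type*) [Group H] : Prop :=
  ∃ (ι : Type) (e : ι → ℕ),
    Nonempty (H ≃* PresentedGroup {w : FreeGroup ι | ∃ i : ι, w = FreeGroup.of i ^ e i})

/-- A subgroup `K` of `H` is *malnormal* if `g K g⁻¹ ∩ K = {1}` for every `g ∉ K`. -/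
def IsMalnormal {H : Type*} [Group H] (K : Subgroup H) : Prop :=
  ∀ g : H, g ∉ K → ∀ x ∈ K, g * x * g⁻¹ ∈ K → x = 1

end FPaper

namespace FPaper

section TreeMetric

open SimpleGraph

variable {V : Type*} {T : SimpleGraph V}

theorem adj_unique_of_dist_lt (hT : T.IsTree) {x y y' z : V} (h : T.Adj x y) (h' : T.Adj x y')
    (hy : T.dist y z < T.dist x z) (hy' : T.dist y' z < T.dist x z) : y = y' := by
  have key : ∀ u, T.Adj x u → T.dist u z < T.dist x z →
      ∃ p : T.Walk x z, p.IsPath ∧ p.snd = u := by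
    intro u hu hlt
    obtain ⟨p, hp⟩ := (hT.connected u z).exists_walk_length_eq_dist
    refine ⟨Walk.cons hu p, Walk.isPath_of_length_eq_dist _ ?_, by simp⟩
    have h1 := hT.connected.dist_triangle (u := x) (v := u) (w := z)
    rw [dist_eq_one_iff_adj.2 hu] at h1
    rw [Walk.length_cons, hp]
    omega
  obtain ⟨p, hp, rfl⟩ := key y h hy
  obtain ⟨q, hq, rfl⟩ := key y' h' hy'
  rw [(hT.existsUnique_path x z).unique hp hq]

/-- On a geodesic between two vertices there is a vertex at each prescribed distance. -/
theorem exists_dist_eq_of_le (hT : T.Connected) (x y : V) {i : ℕ} (hi : i ≤ T.dist x y) :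
    ∃ z, T.dist x z = i ∧ i + T.dist z y = T.dist x y := by
  obtain ⟨p, hp⟩ := (hT x y).exists_walk_length_eq_dist
  have h1 := dist_le (p.take i)
  have h2 := dist_le (p.drop i)
  have h3 := hT.dist_triangle (u := x) (v := p.getVert i) (w := y)
  rw [Walk.take_length] at h1
  rw [Walk.drop_length] at h2
  refine ⟨p.getVert i, ?_, ?_⟩ <;> omega

theorem dist_eq_add_of_adj_step (hT : T.IsTree) (n : ℕ) : ∀ {x x' y z : V}, T.dist x' y = n →
    T.Adj x x' → T.dist x y = n + 1 → T.dist x' z = T.dist x z + 1 →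
      T.dist y z = T.dist y x + T.dist x z := by
  induction n with
  | zero =>
    intro x x' y z h1 h2 h3 h4
    obtain rfl := (hT.connected.dist_eq_zero_iff).1 h1
    rw [dist_comm (u := x') (v := x)]
    omega
  | succ n ih =>
    intro x x' y z h1 h2 h3 h4
    obtain ⟨x'', h5, h6⟩ := exists_dist_eq_of_le hT.connected x' y (i := 1) (by omega)
    have h7 := dist_eq_one_iff_adj.1 h5
    have h8 : T.dist x'' z = T.dist x' z + 1 := by
      rcases hT.dist_eq_dist_add_one_of_adj z h7 with h | h
      · rw [dist_comm (u := z), dist_comm (u := z)] at h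
        have := adj_unique_of_dist_lt hT h7 h2.symm (z := z) (by omega) (by omega)
        subst this
        omega
      · rw [dist_comm (u := z), dist_comm (u := z)] at h
        exact h
    have := ih (x := x') (x' := x'') (y := y) (z := z) (by omega) h7 (by omega) h8
    rw [dist_comm (u := y) (v := x)]
    rw [dist_comm (u := y) (v := x')] at this
    omega

/-- The four-point condition: a tree is `0`-hyperbolic. -/
theorem four_point (hT : T.IsTree) (x y z w : V) :
    T.dist x y + T.dist z w ≤
      max (T.dist x z + T.dist y w) (T.dist x w + T.dist y z) := by
  obtain ⟨n, hn⟩ : ∃ n, T.dist x y = n := ⟨_, rfl⟩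
  induction n generalizing x with
  | zero =>
    obtain rfl := (hT.connected.dist_eq_zero_iff).1 hn
    have := hT.connected.dist_triangle (u := z) (v := x) (w := w)
    rw [dist_comm (u := z) (v := x)] at this
    omega
  | succ n ih =>
    obtain ⟨x', h1, h2⟩ := exists_dist_eq_of_le hT.connected x y (i := 1) (by omega)
    have hadj := dist_eq_one_iff_adj.1 h1
    have h3 := ih x' (by omega)
    have tz := hT.connected.dist_triangle (u := z) (v := x) (w := w)
    have hzx := dist_comm (G := T) (u := z) (v := x)
    have hxy := dist_comm (G := T) (u := x) (v := y)
    have hz := hT.dist_eq_dist_add_one_of_adj z hadj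
    have hw := hT.dist_eq_dist_add_one_of_adj w hadj
    rw [dist_comm (u := z) (v := x), dist_comm (u := z) (v := x')] at hz
    rw [dist_comm (u := w) (v := x), dist_comm (u := w) (v := x')] at hw
    rcases hz with hz | hz
    · rcases hw with hw | hw
      · omega
      · have := dist_eq_add_of_adj_step hT n (y := y) (by omega) hadj (by omega) hw
        omega
    · have := dist_eq_add_of_adj_step hT n (y := y) (by omega) hadj (by omega) hz
      omega

/-- A vertex on a geodesic is determined by its distances to the end points. -/
theorem eq_of_dist_eq_of_geodesic (hT : T.IsTree) {x y z z' : V}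
    (h : T.dist x z + T.dist z y = T.dist x y) (h1 : T.dist x z' = T.dist x z)
    (h2 : T.dist z' y = T.dist z y) : z = z' := by
  have := four_point hT z z' x y
  rw [dist_comm (u := z) (v := x), dist_comm (u := z') (v := x)] at this
  exact (hT.connected.dist_eq_zero_iff).1 (by omega)

end TreeMetric

section TreeAction

open SimpleGraph

variable {V Γ : Type*} {T : SimpleGraph V} [Group Γ] [MulAction Γ V]

theorem dist_smul_smul (hT : T.Connected)
    (hadj : ∀ (g : Γ) (x y : V), T.Adj x y → T.Adj (g • x) (g • y)) (g : Γ) (x y : V) :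
    T.dist (g • x) (g • y) = T.dist x y := by
  have key : ∀ (g : Γ) (x y : V), T.dist (g • x) (g • y) ≤ T.dist x y := by
    intro g x y
    obtain ⟨p, hp⟩ := (hT x y).exists_walk_length_eq_dist
    let f : T →g T := ⟨fun x => g • x, fun h => hadj g _ _ h⟩
    rw [← hp, ← Walk.length_map f p]
    exact dist_le _
  refine le_antisymm (key g x y) ?_
  simpa using key g⁻¹ (g • x) (g • y)

theorem smul_eq_of_geodesic (hT : T.IsTree)
    (hadj : ∀ (g : Γ) (x y : V), T.Adj x y → T.Adj (g • x) (g • y)) {g : Γ} {x y z : V}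
    (hx : g • x = x) (hy : g • y = y) (h : T.dist x z + T.dist z y = T.dist x y) :
    g • z = z := by
  have h1 := dist_smul_smul hT.connected hadj g x z
  have h2 := dist_smul_smul hT.connected hadj g z y
  rw [hx] at h1
  rw [hy] at h2
  exact (eq_of_dist_eq_of_geodesic hT h h1 h2).symm

/-- Two commuting elements with fixed vertices have a common fixed vertex. -/
theorem exists_common_fixed (hT : T.IsTree)
    (hadj : ∀ (g : Γ) (x y : V), T.Adj x y → T.Adj (g • x) (g • y))
    (hpar : ∀ (g : Γ) (x : V), Even (T.dist x (g • x))) {g h : Γ} (hgh : g * h = h * g)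
    (hg : ∃ x : V, g • x = x) (hh : ∃ x : V, h • x = x) :
    ∃ x : V, g • x = x ∧ h • x = x := by
  classical
  obtain ⟨y, hy⟩ := hh
  have hex : ∃ n, ∃ p : V, g • p = p ∧ T.dist p y = n := by
    obtain ⟨x, hx⟩ := hg
    exact ⟨_, x, hx, rfl⟩
  obtain ⟨p, hp, hpn⟩ := Nat.find_spec hex
  have hmin : ∀ q : V, g • q = q → T.dist p y ≤ T.dist q y := by
    intro q hq
    rw [hpn]
    exact Nat.find_min' hex ⟨q, hq, rfl⟩
  refine ⟨p, hp, ?_⟩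
  have hhp : g • h • p = h • p := by rw [← mul_smul, hgh, mul_smul, hp]
  have hd : T.dist (h • p) y = T.dist p y := by
    conv_lhs => rw [← hy]
    exact dist_smul_smul hT.connected hadj h p y
  obtain ⟨m, hm⟩ := hpar h p
  obtain ⟨z, hz1, hz2⟩ := exists_dist_eq_of_le hT.connected p (h • p) (i := m) (by omega)
  have hgz : g • z = z := smul_eq_of_geodesic hT hadj hp hhp (by omega)
  have h1 := hmin z hgz
  have h2 := four_point hT z y p (h • p)
  rw [dist_comm (u := z) (v := p), dist_comm (u := y), dist_comm (u := y)] at h2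
  exact ((hT.connected.dist_eq_zero_iff).1 (by omega)).symm

/-- An abelian group of elliptic automorphisms of a tree has a global fixed vertex, as soon as
the stabilizers of adjacent edges are compatible in the sense of `hedge`. -/
theorem exists_global_fixed (hT : T.IsTree)
    (hadj : ∀ (g : Γ) (x y : V), T.Adj x y → T.Adj (g • x) (g • y))
    (hpar : ∀ (g : Γ) (x : V), Even (T.dist x (g • x)))
    (hedge : ∀ (w x y : V) (g k : Γ), T.Adj w x → T.Adj w y → g ≠ 1 → k ≠ 1 → g * k = k * g →
      g • w = w → k • w = w → g • x = x → k • y = y → g • y = y)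
    {K : Subgroup Γ} (hK : ∀ x ∈ K, ∀ y ∈ K, x * y = y * x)
    (hell : ∀ g ∈ K, ∃ x : V, g • x = x) :
    ∃ x : V, ∀ g ∈ K, g • x = x := by
  have step : ∀ (x y : V), x ≠ y → ∃ z, T.Adj x z ∧ T.dist x z + T.dist z y = T.dist x y ∧
      T.dist x y = T.dist z y + 1 := by
    intro x y hxy
    have := hT.connected.pos_dist_of_ne hxy
    obtain ⟨z, h1, h2⟩ := exists_dist_eq_of_le hT.connected x y (i := 1) (by omega)
    exact ⟨z, dist_eq_one_iff_adj.1 h1, by omega, by omega⟩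
  by_cases huniq : ∃ g ∈ K, ∃ x : V, g • x = x ∧ ∀ y : V, g • y = y → y = x
  · obtain ⟨g, hg, x, hx, hu⟩ := huniq
    refine ⟨x, fun k hk => hu _ ?_⟩
    rw [← mul_smul, hK g hg k hk, mul_smul, hx]
  push Not at huniq
  by_cases htriv : ∀ g ∈ K, g = 1
  · obtain ⟨x⟩ := hT.connected.nonempty
    refine ⟨x, fun g hg => ?_⟩
    rw [htriv g hg, one_smul]
  push Not at htriv
  obtain ⟨g₀, hg₀, hne⟩ := htriv
  obtain ⟨a, ha⟩ := hell g₀ hg₀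
  refine ⟨a, fun k hk => ?_⟩
  rcases eq_or_ne k 1 with rfl | hk1
  · exact one_smul _ _
  have main : ∀ n, ∀ w : V, T.dist w a = n → g₀ • w = w → k • w = w → k • a = a := by
    intro n
    induction n with
    | zero =>
      intro w hw _ h
      rwa [(hT.connected.dist_eq_zero_iff).1 hw] at h
    | succ n ih =>
      intro w hw hgw hkw
      obtain ⟨x', hx', hne'⟩ := huniq k hk w hkw
      obtain ⟨x, hwx, hgeo, -⟩ := step w x' hne'.symm
      have hkx := smul_eq_of_geodesic hT hadj hkw hx' hgeo
      obtain ⟨y, hwy, hgeo', hlen⟩ := step w a (by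
        rintro rfl
        simp at hw)
      have hgy := smul_eq_of_geodesic hT hadj hgw ha hgeo'
      exact ih y (by omega) hgy
        (hedge w x y k g₀ hwx hwy hk1 hne (hK k hk g₀ hg₀) hkw hgw hkx hgy)
  obtain ⟨w, hw1, hw2⟩ := exists_common_fixed hT hadj hpar (hK g₀ hg₀ k hk)
    (hell g₀ hg₀) (hell k hk)
  exact main _ w rfl hw1 hw2

/-- A fixed point free automorphism `g` translates a vertex of its axis by the same amount at
every step. -/
theorem exists_translation_length (hT : T.IsTree)
    (hadj : ∀ (g : Γ) (x y : V), T.Adj x y → T.Adj (g • x) (g • y))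
    (hpar : ∀ (g : Γ) (x : V), Even (T.dist x (g • x))) {g : Γ} (hg : ∀ x : V, g • x ≠ x) :
    ∃ (v : V) (l : ℕ), 0 < l ∧ ∀ n : ℕ, T.dist v (g ^ n • v) = n * l := by
  classical
  have hex : ∃ n, ∃ p : V, T.dist p (g • p) = n := by
    obtain ⟨x⟩ := hT.connected.nonempty
    exact ⟨_, x, rfl⟩
  obtain ⟨v, hv⟩ := Nat.find_spec hex
  have hmin : ∀ q : V, T.dist v (g • v) ≤ T.dist q (g • q) := by
    intro q
    rw [hv]
    exact Nat.find_min' hex ⟨q, rfl⟩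
  have hd := dist_smul_smul hT.connected hadj g
  have hpos := hT.connected.pos_dist_of_ne (hg v).symm
  obtain ⟨m, hm⟩ := hpar g v
  have h2 : 2 * T.dist v (g • v) ≤ T.dist v (g • g • v) := by
    obtain ⟨z, hz1, hz2⟩ := exists_dist_eq_of_le hT.connected v (g • v) (i := m) (by omega)
    have h1 := hmin z
    have h3 := four_point hT z (g • z) (g • v) (g • g • v)
    have h4 := four_point hT v (g • v) z (g • g • v)
    have h5 := dist_comm (G := T) (u := g • z) (v := g • v)
    have h6 := dist_comm (G := T) (u := g • v) (v := z)
    rw [hd, hd] at h3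
    rw [hd v (g • v)] at h4
    rw [hd v z] at h5
    have h7 := hd v (g • v)
    rw [h5] at h3
    omega
  have hdn : ∀ (n : ℕ) (x y : V), T.dist (g ^ n • x) (g ^ n • y) = T.dist x y :=
    fun n => dist_smul_smul hT.connected hadj (g ^ n)
  have hup : ∀ n : ℕ, T.dist v (g ^ n • v) ≤ n * T.dist v (g • v) := by
    intro n
    induction n with
    | zero => simp
    | succ n ih =>
      have h3 := hT.connected.dist_triangle (u := v) (v := g ^ n • v) (w := g ^ (n + 1) • v)
      rw [pow_succ, mul_smul, hdn] at h3
      rw [pow_succ, mul_smul, add_mul]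
      omega
  refine ⟨v, _, hpos, fun n => le_antisymm (hup n) ?_⟩
  have : n * T.dist v (g • v) ≤ T.dist v (g ^ n • v) ∧
      (n + 1) * T.dist v (g • v) ≤ T.dist v (g ^ (n + 1) • v) := by
    induction n with
    | zero => simp
    | succ n ih =>
      refine ⟨ih.2, ?_⟩
      have h3 := four_point hT (g ^ n • v) (g ^ (n + 2) • v) v (g ^ (n + 1) • v)
      have e1 : T.dist (g ^ n • v) (g ^ (n + 2) • v) = T.dist v (g • g • v) := by
        rw [pow_add, mul_smul, hdn, pow_two, mul_smul]
      have e2 : T.dist (g ^ n • v) (g ^ (n + 1) • v) = T.dist v (g • v) := by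
        rw [pow_succ, mul_smul, hdn]
      have e3 : T.dist (g ^ (n + 2) • v) (g ^ (n + 1) • v) = T.dist v (g • v) := by
        rw [show n + 2 = (n + 1) + 1 from rfl, pow_succ g (n + 1), mul_smul, hdn, dist_comm]
      have e4 : T.dist (g ^ n • v) v ≤ n * T.dist v (g • v) := by
        rw [dist_comm]
        exact hup n
      have e5 : T.dist (g ^ (n + 2) • v) v = T.dist v (g ^ (n + 2) • v) := dist_comm
      have := ih.2
      rw [add_mul] at this
      rw [e1, e2, e3, e5] at h3
      rw [show n + 1 + 1 = n + 2 from rfl, add_mul]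
      omega
  exact this.1

/-- The centralizer of a fixed point free automorphism of a tree acts on its axis by
translations, the kernel of this action fixing an edge. -/
theorem exists_translation_hom (hT : T.IsTree)
    (hadj : ∀ (g : Γ) (x y : V), T.Adj x y → T.Adj (g • x) (g • y))
    (hpar : ∀ (g : Γ) (x : V), Even (T.dist x (g • x))) {g : Γ} (hg : ∀ x : V, g • x ≠ x) :
    ∃ (τ : Subgroup.centralizer {g} →* Multiplicative ℤ) (a b : V), T.Adj a b ∧
      ∀ k, τ k = 1 → k • a = a ∧ k • b = b := by
  obtain ⟨v, l, hl, hlen⟩ := exists_translation_length hT hadj hpar hg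
  have hd := dist_smul_smul hT.connected hadj
  have htri : ∀ x y z : V, T.dist x z ≤ T.dist x y + T.dist y z :=
    fun x y z => hT.connected.dist_triangle
  have hcomm : ∀ (k : Subgroup.centralizer {g}) (n : ℕ), (k : Γ) * g ^ n = g ^ n * k := by
    intro k n
    have := Subgroup.mem_centralizer_singleton_iff.1 k.2
    exact (Commute.pow_right this n)
  let P : Subgroup.centralizer {g} → ℤ → Prop := fun k b => ∃ N : ℕ,
    (T.dist ((k : Γ) • v) (g ^ N • v) : ℤ) ≤ N * l + b ∧
    (T.dist (g ^ N • (k : Γ) • v) v : ℤ) ≤ N * l - b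
  have hmul : ∀ k k' b b', P k b → P k' b' → P (k * k') (b + b') := by
    rintro k k' b b' ⟨N, h1, h2⟩ ⟨N', h1', h2'⟩
    refine ⟨N + N', ?_, ?_⟩
    · have := htri (((k * k' : Subgroup.centralizer {g}) : Γ) • v) ((k : Γ) • g ^ N' • v)
        (g ^ (N + N') • v)
      rw [Subgroup.coe_mul, mul_smul, hd, ← mul_smul (k : Γ) (g ^ N'), hcomm, add_comm N,
        pow_add, mul_smul, mul_smul, hd] at this
      rw [Subgroup.coe_mul, mul_smul, add_comm N, pow_add, mul_smul]
      push_cast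
      linarith [(Nat.cast_le (α := ℤ)).2 this, Nat.cast_add (R := ℤ)
        (T.dist ((k' : Γ) • v) (g ^ N' • v)) (T.dist ((k : Γ) • v) (g ^ N • v))]
    · have := htri (g ^ (N + N') • ((k * k' : Subgroup.centralizer {g}) : Γ) • v)
        (g ^ N • (k : Γ) • v) v
      have e : g ^ (N + N') • ((k * k' : Subgroup.centralizer {g}) : Γ) • v =
          g ^ N • (k : Γ) • g ^ N' • (k' : Γ) • v := by
        simp only [Subgroup.coe_mul, ← mul_smul, pow_add]
        congr 1
        rw [mul_assoc, ← mul_assoc (g ^ N'), ← hcomm, mul_assoc]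
      rw [e, hd, hd] at this
      rw [e]
      push_cast
      linarith [(Nat.cast_le (α := ℤ)).2 this, Nat.cast_add (R := ℤ)
        (T.dist (g ^ N' • (k' : Γ) • v) v) (T.dist (g ^ N • (k : Γ) • v) v)]
  have hle : ∀ k b b', P k b → P k b' → b' ≤ b := by
    rintro k b b' ⟨N, h1, -⟩ ⟨N', -, h2⟩
    have := htri (g ^ (N' + N) • v) (g ^ N' • (k : Γ) • v) v
    rw [SimpleGraph.dist_comm (u := g ^ (N' + N) • v) (v := v), hlen, pow_add, mul_smul, hd,
      SimpleGraph.dist_comm (u := g ^ N • v)] at this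
    have h3 := (Nat.cast_le (α := ℤ)).2 this
    push_cast at h3
    linarith
  have hexist : ∀ k : Subgroup.centralizer {g}, ∃ b : ℤ, P k b ∧
      |b| = T.dist ((k : Γ) • v) v := by
    intro k
    obtain ⟨x, hx⟩ : ∃ x, x = (k : Γ) • v := ⟨_, rfl⟩
    obtain ⟨N, hN⟩ : ∃ N, N = T.dist x v := ⟨_, rfl⟩
    have hlenx : ∀ n : ℕ, T.dist x (g ^ n • x) = n * l := by
      intro n
      rw [hx, ← mul_smul, ← hcomm, mul_smul, hd, hlen]
    have hNl : N ≤ N * l := Nat.le_mul_of_pos_right N hl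
    have e2 : ∀ y : V, g ^ (2 * N) • y = g ^ N • g ^ N • y := by
      intro y
      rw [two_mul, pow_add, mul_smul]
    have c1 := hlen N
    have c2 := hlen (2 * N)
    have c4 := hlen (2 * N + 2 * N)
    have x2 := hlenx (2 * N)
    have f1 := four_point hT (g ^ (2 * N) • x) (g ^ (2 * N) • v) (g ^ (2 * N) • g ^ (2 * N) • v) v
    rw [hd, hd, hd, ← mul_smul, ← pow_add, dist_comm (u := g ^ (2 * N + 2 * N) • v) (v := v), c4,
      dist_comm (u := g ^ (2 * N) • v) (v := v), c2] at f1
    have d1 : T.dist (g ^ (2 * N) • v) (g ^ N • v) = N * l := by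
      rw [e2, hd, SimpleGraph.dist_comm, c1]
    have d2 : T.dist (g ^ (2 * N) • x) (g ^ N • v) = T.dist (g ^ N • x) v := by
      rw [e2, hd]
    have t1 := htri x v (g ^ N • v)
    have t2 := htri (g ^ N • x) (g ^ N • v) v
    rw [hd, dist_comm (u := g ^ N • v)] at t2
    rw [add_mul, mul_assoc] at f1
    rw [mul_assoc] at x2 c2
    rcases le_total (T.dist (g ^ (2 * N) • x) v) (T.dist x (g ^ (2 * N) • v)) with h | h
    · refine ⟨T.dist x v, ⟨N, ?_, ?_⟩, by rw [hx]; simp⟩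
      · rw [← hx]
        rw [c1] at t1
        have := (Nat.cast_le (α := ℤ)).2 t1
        push_cast at this
        linarith
      · have f2 := four_point hT (g ^ (2 * N) • x) (g ^ N • v) x (g ^ (2 * N) • v)
        rw [hd, dist_comm (u := g ^ (2 * N) • x) (v := x), x2, d2,
          dist_comm (u := g ^ N • v) (v := g ^ (2 * N) • v), d1,
          dist_comm (u := g ^ N • v) (v := x)] at f2
        rw [← hx, le_sub_iff_add_le]
        norm_cast
        omega
    · refine ⟨-T.dist x v, ⟨N, ?_, ?_⟩, by rw [hx]; simp⟩
      · have f2 := four_point hT x (g ^ N • v) (g ^ (2 * N) • x) v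
        rw [x2, dist_comm (u := g ^ N • v) (v := g ^ (2 * N) • x), d2,
          dist_comm (u := g ^ N • v) (v := v)] at f2
        rw [← hx, ← sub_eq_add_neg, le_sub_iff_add_le]
        norm_cast
        omega
      · rw [← hx]
        rw [c1] at t2
        have := (Nat.cast_le (α := ℤ)).2 t2
        push_cast at this
        linarith
  choose f hf1 hf2 using hexist
  have hpos := hT.connected.pos_dist_of_ne (hg v).symm
  obtain ⟨u, hu1, hu2⟩ := exists_dist_eq_of_le hT.connected v (g • v) (i := 1) (by omega)
  refine ⟨MonoidHom.mk' (fun k => Multiplicative.ofAdd (f k)) fun k k' => ?_, v, u,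
    dist_eq_one_iff_adj.1 hu1, fun k hk => ?_⟩
  · have h := hmul k k' _ _ (hf1 k) (hf1 k')
    rw [← ofAdd_add]
    exact congrArg _ (le_antisymm (hle _ _ _ h (hf1 _)) (hle _ _ _ (hf1 _) h))
  · have h0 : f k = 0 := hk
    have h1 := hf2 k
    rw [h0, abs_zero] at h1
    have hkv : (k : Γ) • v = v := (hT.connected.dist_eq_zero_iff).1 (by exact_mod_cast h1.symm)
    refine ⟨hkv, smul_eq_of_geodesic hT hadj (g := (k : Γ)) hkv (y := g • v) ?_ (by omega)⟩
    have := hcomm k 1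
    rw [pow_one] at this
    rw [← mul_smul, this, mul_smul, hkv]

end TreeAction

section BassSerre

open Monoid Monoid.PushoutI Monoid.PushoutI.NormalWord

variable {ι : Type*} {G : ι → Type*} [∀ i, Group (G i)] {H : Type*} [Group H]
  (φ : ∀ i, H →* G i)

/-- The base group (index `none`) and the factors (index `some i`) of an amalgamated product. -/
def vertexGroup : Option ι → Subgroup (PushoutI φ)
  | none => (base φ).range
  | some i => (of i : G i →* PushoutI φ).range

theorem vertexGroup_none_le (i : ι) : vertexGroup φ none ≤ vertexGroup φ (some i) := by
  rintro _ ⟨h, rfl⟩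
  exact ⟨φ i h, of_apply_eq_base φ i h⟩

/-- The vertices of the Bass–Serre tree of an amalgamated product: the left cosets of the base
group and of the factors. -/
abbrev BSVertex : Type _ := Σ j : Option ι, PushoutI φ ⧸ vertexGroup φ j

variable {φ} in
/-- The vertex given by the coset of `g`. -/
def bsVertex (j : Option ι) (g : PushoutI φ) : BSVertex φ :=
  ⟨j, (g : PushoutI φ ⧸ vertexGroup φ j)⟩

variable {φ}

theorem bsVertex_surjective (x : BSVertex φ) : ∃ j g, x = bsVertex j g := by
  obtain ⟨j, q⟩ := x
  obtain ⟨g, rfl⟩ := QuotientGroup.mk_surjective q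
  exact ⟨j, g, rfl⟩

theorem bsVertex_eq_iff {j : Option ι} {g g' : PushoutI φ} :
    (bsVertex j g : BSVertex φ) = bsVertex j g' ↔ g⁻¹ * g' ∈ vertexGroup φ j := by
  rw [← QuotientGroup.eq]
  simp [bsVertex]

theorem smul_bsVertex (j : Option ι) (k g : PushoutI φ) :
    k • (bsVertex j g : BSVertex φ) = bsVertex j (k * g) := rfl

theorem smul_bsVertex_eq_iff {j : Option ι} {k g : PushoutI φ} :
    k • (bsVertex j g : BSVertex φ) = bsVertex j g ↔ g⁻¹ * k * g ∈ vertexGroup φ j := by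
  rw [smul_bsVertex, eq_comm, bsVertex_eq_iff, mul_assoc]

variable (φ) in
/-- The Bass–Serre tree of an amalgamated product. -/
def bsGraph : SimpleGraph (BSVertex φ) where
  Adj x y := ∃ g i, (x = bsVertex none g ∧ y = bsVertex (some i) g) ∨
    (x = bsVertex (some i) g ∧ y = bsVertex none g)
  symm := ⟨by
    rintro x y ⟨g, i, h | h⟩
    · exact ⟨g, i, Or.inr h.symm⟩
    · exact ⟨g, i, Or.inl h.symm⟩⟩
  loopless := ⟨by
    rintro x ⟨g, i, ⟨h, h'⟩ | ⟨h, h'⟩⟩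
    · exact absurd (congrArg Sigma.fst (h.symm.trans h')) (by simp [bsVertex])
    · exact absurd (congrArg Sigma.fst (h.symm.trans h')) (by simp [bsVertex])⟩

theorem bsGraph_adj_smul (k : PushoutI φ) (x y : BSVertex φ) (h : (bsGraph φ).Adj x y) :
    (bsGraph φ).Adj (k • x) (k • y) := by
  obtain ⟨g, i, ⟨rfl, rfl⟩ | ⟨rfl, rfl⟩⟩ := h
  · exact ⟨k * g, i, Or.inl ⟨rfl, rfl⟩⟩
  · exact ⟨k * g, i, Or.inr ⟨rfl, rfl⟩⟩

theorem bsGraph_connected : (bsGraph φ).Connected := by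
  have key : ∀ k g : PushoutI φ, (bsGraph φ).Reachable (bsVertex none g)
      (bsVertex none (g * k)) := by
    intro k
    induction k using PushoutI.induction_on with
    | of i x =>
      intro g
      have h1 : (bsGraph φ).Adj (bsVertex none g) (bsVertex (some i) g) :=
        ⟨g, i, Or.inl ⟨rfl, rfl⟩⟩
      have h2 : (bsGraph φ).Adj (bsVertex (some i) (g * of i x)) (bsVertex none (g * of i x)) :=
        ⟨_, i, Or.inr ⟨rfl, rfl⟩⟩
      rw [(bsVertex_eq_iff.2 (by
        rw [inv_mul_cancel_left]
        exact ⟨x, rfl⟩) : (bsVertex (some i) g : BSVertex φ) =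
          bsVertex (some i) (g * of i x))] at h1
      exact h1.reachable.trans h2.reachable
    | base h =>
      intro g
      rw [(bsVertex_eq_iff.2 (by
        rw [inv_mul_cancel_left]
        exact ⟨h, rfl⟩) : (bsVertex none g : BSVertex φ) = bsVertex none (g * base φ h))]
    | mul x y hx hy =>
      intro g
      rw [← mul_assoc]
      exact (hx g).trans (hy _)
  have key' : ∀ x : BSVertex φ, (bsGraph φ).Reachable (bsVertex none 1) x := by
    intro x
    obtain ⟨j | i, g, rfl⟩ := bsVertex_surjective x
    · simpa using key g 1
    · have h1 : (bsGraph φ).Adj (bsVertex none g) (bsVertex (some i) g) :=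
        ⟨g, i, Or.inl ⟨rfl, rfl⟩⟩
      have h2 := key g 1
      rw [one_mul] at h2
      exact h2.trans h1.reachable
  have : Nonempty (BSVertex φ) := ⟨bsVertex none 1⟩
  exact ⟨fun x y => (key' x).symm.trans (key' y)⟩

theorem even_dist_bsGraph_smul (k : PushoutI φ) (x : BSVertex φ) :
    Even ((bsGraph φ).dist x (k • x)) := by
  let c : (bsGraph φ).Coloring Bool := SimpleGraph.Coloring.mk (fun x => x.1.isNone) (by
    rintro x y ⟨g, i, ⟨rfl, rfl⟩ | ⟨rfl, rfl⟩⟩ <;> simp [bsVertex])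
  obtain ⟨p, hp⟩ := (bsGraph_connected x (k • x)).exists_walk_length_eq_dist
  rw [← hp, c.even_length_iff_congr p]
  exact Iff.rfl

section NormalForm

variable {d : Transversal φ} [DecidableEq ι] [∀ i, DecidableEq (G i)]

theorem length_eq_of_head_mem (i : ι) (w : NormalWord d)
    (h : (equivPair i w).head ∈ (φ i).range) :
    w.toList.length = (equivPair i w).tail.toList.length := by
  obtain ⟨p, rfl⟩ := (equivPair i).symm.surjective w
  rw [Equiv.apply_symm_apply] at h ⊢
  change (CoprodI.Word.rcons _).toList.length = _
  rw [CoprodI.Word.rcons, dif_pos]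
  exact (Subgroup.IsComplement.coe_equiv_snd_eq_one_iff_mem _ (d.one_mem _)).2 h

theorem length_eq_of_head_notMem (i : ι) (w : NormalWord d)
    (h : (equivPair i w).head ∉ (φ i).range) :
    w.toList.length = (equivPair i w).tail.toList.length + 1 ∧ w.fstIdx = some i := by
  obtain ⟨p, rfl⟩ := (equivPair i).symm.surjective w
  rw [Equiv.apply_symm_apply] at h ⊢
  have hne : ¬ (((d.compl i).equiv p.head).2 : G i) = 1 := fun h' =>
    h ((Subgroup.IsComplement.coe_equiv_snd_eq_one_iff_mem _ (d.one_mem _)).1 h')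
  change (CoprodI.Word.rcons _).toList.length = _ ∧ (CoprodI.Word.rcons _).fstIdx = _
  rw [CoprodI.Word.rcons, dif_neg hne]
  exact ⟨by simp [CoprodI.Word.cons], by simp⟩

end NormalForm

theorem bsGraph_isAcyclic (hφ : ∀ i, Function.Injective (φ i)) : (bsGraph φ).IsAcyclic := by
  classical
  obtain ⟨d⟩ := transversal_nonempty φ hφ
  let nf : PushoutI φ → NormalWord d := fun g => g⁻¹ • empty
  let len : PushoutI φ → ℕ := fun g => (nf g).toList.length
  let tl : ι → PushoutI φ → ℕ := fun i g => (equivPair i (nf g)).tail.toList.length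
  have hpair : ∀ i g x, equivPair i (nf (g * of i x)) =
      { equivPair i (nf g) with head := x⁻¹ * (equivPair i (nf g)).head } := by
    intro i g x
    simp only [nf, mul_inv_rev, mul_smul, ← map_inv]
    rw [summand_smul_def, Equiv.apply_symm_apply]
  have hlen : ∀ g h, h ∈ vertexGroup φ none → len (g * h) = len g := by
    rintro g _ ⟨h, rfl⟩
    simp only [len, nf, mul_inv_rev, mul_smul, ← map_inv]
    rfl
  have htl : ∀ i g h, h ∈ vertexGroup φ (some i) → tl i (g * h) = tl i g := by
    rintro i g _ ⟨h, rfl⟩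
    simp only [tl]
    rw [hpair]
  let depth : BSVertex φ → ℕ := fun x => match x with
    | ⟨none, q⟩ => 2 * len q.out
    | ⟨some i, q⟩ => 2 * tl i q.out + 1
  have hdn : ∀ g, depth (bsVertex none g) = 2 * len g := by
    intro g
    obtain ⟨h, hh⟩ := QuotientGroup.mk_out_eq_mul (vertexGroup φ none) g
    change 2 * len (Quotient.out _) = _
    rw [hh, hlen _ _ h.2]
  have hds : ∀ i g, depth (bsVertex (some i) g) = 2 * tl i g + 1 := by
    intro i g
    obtain ⟨h, hh⟩ := QuotientGroup.mk_out_eq_mul (vertexGroup φ (some i)) g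
    change 2 * tl i (Quotient.out _) + 1 = _
    rw [hh, htl _ _ _ h.2]
  have huniq : ∀ u y y', (bsGraph φ).Adj u y → (bsGraph φ).Adj u y' → depth y ≤ depth u →
      depth y' ≤ depth u → y = y' := by
    intro u y y' h h' hy hy'
    obtain ⟨j | i, g, rfl⟩ := bsVertex_surjective u
    · have key : ∀ z, (bsGraph φ).Adj (bsVertex none g) z → depth z ≤ depth (bsVertex none g) →
          ∃ i, z = bsVertex (some i) g ∧ (nf g).fstIdx = some i := by
        rintro z ⟨g', i, ⟨h1, rfl⟩ | ⟨h1, rfl⟩⟩ hz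
        · have h2 : (bsVertex (some i) g' : BSVertex φ) = bsVertex (some i) g :=
            (bsVertex_eq_iff.2 (vertexGroup_none_le φ i (bsVertex_eq_iff.1 h1))).symm
          refine ⟨i, h2, ?_⟩
          rw [h2, hdn, hds] at hz
          by_cases hmem : (equivPair i (nf g)).head ∈ (φ i).range
          · have := length_eq_of_head_mem i (nf g) hmem
            simp only [len, tl] at hz
            omega
          · exact (length_eq_of_head_notMem i (nf g) hmem).2
        · exact absurd (congrArg Sigma.fst h1) (by simp [bsVertex])
      obtain ⟨i, rfl, h1⟩ := key y h hy
      obtain ⟨i', rfl, h2⟩ := key y' h' hy'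
      rw [h1] at h2
      rw [Option.some.inj h2]
    · have key : ∀ z, (bsGraph φ).Adj (bsVertex (some i) g) z →
          depth z ≤ depth (bsVertex (some i) g) →
          ∃ x : G i, z = bsVertex none (g * of i x) ∧
            x⁻¹ * (equivPair i (nf g)).head ∈ (φ i).range := by
        rintro z ⟨g', i', ⟨h1, rfl⟩ | ⟨h1, rfl⟩⟩ hz
        · exact absurd (congrArg Sigma.fst h1) (by simp [bsVertex])
        · obtain rfl : i = i' := Option.some.inj (congrArg Sigma.fst h1)
          obtain ⟨x, hx⟩ := bsVertex_eq_iff.1 h1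
          obtain rfl : g' = g * of i x := by rw [hx, mul_inv_cancel_left]
          refine ⟨x, rfl, ?_⟩
          rw [hdn, hds] at hz
          have h2 : tl i (g * of i x) = tl i g := htl i g _ ⟨x, rfl⟩
          by_contra hmem
          have h3 := (length_eq_of_head_notMem i (nf (g * of i x)) (by rwa [hpair])).1
          simp only [len, tl] at hz h2
          omega
      obtain ⟨x, rfl, h1⟩ := key y h hy
      obtain ⟨x', rfl, h2⟩ := key y' h' hy'
      rw [bsVertex_eq_iff]
      obtain ⟨c, hc⟩ := (φ i).range.mul_mem h1 ((φ i).range.inv_mem h2)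
      refine ⟨c, ?_⟩
      rw [← of_apply_eq_base φ i, hc]
      simp only [map_mul, map_inv]
      group
  intro u c hc
  obtain ⟨m, hm, hmax⟩ := c.support.toFinset.exists_max_image depth ⟨u, by simp⟩
  rw [List.mem_toFinset] at hm
  have hc' := hc.rotate hm
  have hmax' : ∀ z ∈ (c.rotate m hm).support, depth z ≤ depth m := by
    intro z hz
    refine hmax z ?_
    rw [List.mem_toFinset]
    exact (SimpleGraph.Walk.mem_support_rotate_iff ..).1 hz
  refine hc'.snd_ne_penultimate (huniq m _ _ ?_ ?_ (hmax' _ ?_) (hmax' _ ?_))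
  · exact SimpleGraph.Walk.adj_snd hc'.not_nil
  · exact (SimpleGraph.Walk.adj_penultimate hc'.not_nil).symm
  · exact SimpleGraph.Walk.getVert_mem_support ..
  · exact SimpleGraph.Walk.getVert_mem_support ..

theorem bsGraph_isTree (hφ : ∀ i, Function.Injective (φ i)) : (bsGraph φ).IsTree :=
  ⟨bsGraph_connected, bsGraph_isAcyclic hφ⟩

end BassSerre

section AbelianSubgroups

/-- Every abelian subgroup is cyclic. -/
def AbelianSubgroupsCyclic (S : Type*) [Group S] : Prop :=
  ∀ K : Subgroup S, (∀ x ∈ K, ∀ y ∈ K, x * y = y * x) → IsCyclic K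

/-- Centralizers of elements of infinite order are abelian. -/
def CentralizersAbelian (S : Type*) [Group S] : Prop :=
  ∀ g : S, ¬ IsOfFinOrder g → ∀ x y : S, Commute g x → Commute g y → Commute x y

theorem AbelianSubgroupsCyclic.isCyclic_of_injective {S A : Type*} [Group S] [Group A]
    (hS : AbelianSubgroupsCyclic S) (hA : ∀ x y : A, x * y = y * x) (f : A →* S)
    (hf : Function.Injective f) : IsCyclic A := by
  have : IsCyclic f.range := hS _ (by
    rintro _ ⟨x, rfl⟩ _ ⟨y, rfl⟩
    rw [← map_mul, hA, map_mul])
  exact (MonoidHom.ofInjective hf).isCyclic.2 this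

theorem AbelianSubgroupsCyclic.of_injective {S A : Type*} [Group S] [Group A]
    (hS : AbelianSubgroupsCyclic S) (f : A →* S) (hf : Function.Injective f) :
    AbelianSubgroupsCyclic A := fun K hK =>
  hS.isCyclic_of_injective (fun x y => Subtype.ext (hK x x.2 y y.2)) (f.comp K.subtype)
    (hf.comp K.subtype_injective)

theorem CentralizersAbelian.of_injective {S A : Type*} [Group S] [Group A]
    (hS : CentralizersAbelian S) (f : A →* S) (hf : Function.Injective f) :
    CentralizersAbelian A := by
  intro g hg x y hx hy
  have := hS (f g) (by rwa [hf.isOfFinOrder_iff]) (f x) (f y) (hx.map f) (hy.map f)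
  exact hf (by rw [map_mul, map_mul, this.eq])

theorem AbelianSubgroupsCyclic.of_isCyclic (S : Type*) [Group S] [IsCyclic S] :
    AbelianSubgroupsCyclic S := fun _ _ => inferInstance

theorem AbelianSubgroupsCyclic.isCyclic_of_conj_mem {S Γ : Type*} [Group S] [Group Γ]
    (hS : AbelianSubgroupsCyclic S) (f : S →* Γ) (hf : Function.Injective f) (g : Γ)
    {K : Subgroup Γ} (hK : ∀ x ∈ K, ∀ y ∈ K, x * y = y * x)
    (hconj : ∀ k ∈ K, g⁻¹ * k * g ∈ f.range) : IsCyclic K := by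
  let c : K →* f.range := ((MulAut.conj g⁻¹).toMonoidHom.comp K.subtype).codRestrict f.range
    (fun k => by simpa using hconj k k.2)
  refine hS.isCyclic_of_injective (fun x y => Subtype.ext (hK x x.2 y y.2))
    ((MonoidHom.ofInjective hf).symm.toMonoidHom.comp c) ?_
  refine (MonoidHom.ofInjective hf).symm.injective.comp ?_
  intro x y hxy
  have h := congrArg Subtype.val hxy
  exact Subtype.ext ((MulAut.conj g⁻¹).injective h)

theorem not_isOfFinOrder_zpow {S : Type*} [Group S] {g : S} (hg : ¬ IsOfFinOrder g) {n : ℤ}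
    (hn : n ≠ 0) : ¬ IsOfFinOrder (g ^ n) := by
  rw [isOfFinOrder_iff_zpow_eq_one] at hg ⊢
  rintro ⟨m, hm, h⟩
  exact hg ⟨n * m, mul_ne_zero hn hm, by rw [zpow_mul, h]⟩

theorem not_isOfFinOrder_conj {S : Type*} [Group S] {g : S} (hg : ¬ IsOfFinOrder g) (a : S) :
    ¬ IsOfFinOrder (a * g * a⁻¹) := by
  have := (MulAut.conj a).injective.isOfFinOrder_iff (f := (MulAut.conj a).toMonoidHom) (x := g)
  simpa using this.not.2 hg

/-- Commuting nontrivial elements of two conjugates of an infinite cyclic subgroup lie in the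
same conjugate. -/
theorem conj_zpow_mem_of_commute {S : Type*} [Group S] (hS : AbelianSubgroupsCyclic S)
    (hS' : CentralizersAbelian S) {u : S} (hu : ¬ IsOfFinOrder u) {a b : S} {s t : ℤ}
    (hs : s ≠ 0) (ht : t ≠ 0) (h : Commute (a * u ^ s * a⁻¹) (b * u ^ t * b⁻¹)) :
    ∃ m : ℤ, a * u ^ s * a⁻¹ = b * u ^ m * b⁻¹ := by
  obtain ⟨p, hp⟩ : ∃ p, p = a * u * a⁻¹ := ⟨_, rfl⟩
  obtain ⟨q, hq⟩ : ∃ q, q = b * u * b⁻¹ := ⟨_, rfl⟩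
  have hpn : ∀ n : ℤ, a * u ^ n * a⁻¹ = p ^ n := fun n => by rw [hp, conj_zpow]
  have hqn : ∀ n : ℤ, b * u ^ n * b⁻¹ = q ^ n := fun n => by rw [hq, conj_zpow]
  have hpi : ¬ IsOfFinOrder p := hp ▸ not_isOfFinOrder_conj hu a
  have hqi : ¬ IsOfFinOrder q := hq ▸ not_isOfFinOrder_conj hu b
  rw [hpn, hqn] at h
  have hpt : ∀ n : ℤ, p ^ n = (MulAut.conj (a * b⁻¹)) (q ^ n) := by
    intro n
    rw [← hpn, ← hqn, MulAut.conj_apply]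
    group
  have habel := hS' _ (not_isOfFinOrder_zpow hpi hs)
  have hcyc : IsCyclic (Subgroup.centralizer {p ^ s}) := hS _ (by
    intro x hx y hy
    rw [Subgroup.mem_centralizer_singleton_iff] at hx hy
    exact habel x y (Eq.symm hx) (Eq.symm hy))
  obtain ⟨⟨c, hc⟩, hgen⟩ := hcyc.exists_generator
  have hcp : Commute (p ^ s) c := (Subgroup.mem_centralizer_singleton_iff.1 hc).symm
  have hgen' : ∀ x, Commute (p ^ s) x → ∃ n : ℤ, c ^ n = x := by
    intro x hx
    obtain ⟨n, hn⟩ := hgen ⟨x, Subgroup.mem_centralizer_singleton_iff.2 hx.symm.eq⟩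
    exact ⟨n, congrArg Subtype.val hn⟩
  have hsq : Commute (p ^ s) q := hS' _ (not_isOfFinOrder_zpow hqi ht) _ _ h.symm
    ((Commute.refl q).zpow_left t)
  have hcq : Commute (q ^ t) c := habel _ _ h hcp
  have hpt' : Commute (p ^ t) (MulAut.conj (a * b⁻¹) c) := by
    rw [hpt]
    exact hcq.map (MulAut.conj (a * b⁻¹))
  have hsc : Commute (p ^ s) (MulAut.conj (a * b⁻¹) c) :=
    hS' _ (not_isOfFinOrder_zpow hpi ht) _ _ ((Commute.refl p).zpow_zpow t s) hpt'
  obtain ⟨r, hr⟩ := hgen' _ hsq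
  obtain ⟨e, he⟩ := hgen' _ hsc
  refine ⟨e * s, ?_⟩
  rw [hpn, hqn, hpt, map_zpow, ← hr, map_zpow, ← he]
  simp only [← zpow_mul]
  congr 1
  ring

/-- An abelian group that is an extension of a subgroup of `ℤ` by a subgroup of `ℤ` is cyclic or
free abelian of rank two. -/
theorem isCyclic_or_equiv_int_prod {A : Type*} [CommGroup A] (τ : A →* Multiplicative ℤ)
    (κ : τ.ker →* Multiplicative ℤ) (hκ : Function.Injective κ) :
    IsCyclic A ∨ Nonempty (A ≃* Multiplicative (ℤ × ℤ)) := by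
  have hker : IsCyclic τ.ker := isCyclic_of_injective κ hκ
  obtain ⟨c, hc⟩ := hker.exists_generator
  obtain ⟨⟨_, t, rfl⟩, ht⟩ := (inferInstance : IsCyclic τ.range).exists_generator
  have hτ : ∀ x, ∃ n : ℤ, τ x = τ t ^ n := by
    intro x
    obtain ⟨n, hn⟩ := ht ⟨τ x, x, rfl⟩
    exact ⟨n, (congrArg Subtype.val hn).symm⟩
  have hdecomp : ∀ x, ∃ m n : ℤ, x = t ^ n * (c : A) ^ m := by
    intro x
    obtain ⟨n, hn⟩ := hτ x
    obtain ⟨m, hm⟩ := hc ⟨(t ^ n)⁻¹ * x, by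
      rw [MonoidHom.mem_ker, map_mul, map_inv, map_zpow, hn, inv_mul_cancel]⟩
    have := congrArg Subtype.val hm
    simp only [Subgroup.coe_zpow] at this
    exact ⟨m, n, by rw [this, mul_inv_cancel_left]⟩
  by_cases h1 : τ t = 1
  · left
    have h : ∀ x, x ∈ τ.ker := by
      intro x
      obtain ⟨n, hn⟩ := hτ x
      rw [MonoidHom.mem_ker, hn, h1, one_zpow]
    refine ⟨c, fun x => ?_⟩
    obtain ⟨m, hm⟩ := hc ⟨x, h x⟩
    exact ⟨m, congrArg Subtype.val hm⟩
  by_cases h2 : c = 1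
  · left
    refine ⟨t, fun x => ?_⟩
    obtain ⟨m, n, rfl⟩ := hdecomp x
    exact ⟨n, by simp [h2]⟩
  right
  have hz : ∀ (z : Multiplicative ℤ) (n : ℤ), z ≠ 1 → z ^ n = 1 → n = 0 := by
    intro z n hz h
    have h' : n * z.toAdd = 0 := by simpa using congrArg Multiplicative.toAdd h
    rcases mul_eq_zero.1 h' with h' | h'
    · exact h'
    · exact absurd h' hz
  let f : Multiplicative (ℤ × ℤ) →* A := MonoidHom.mk'
    (fun z => t ^ z.toAdd.1 * (c : A) ^ z.toAdd.2) (fun x y => by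
      simp only [toAdd_mul, Prod.fst_add, Prod.snd_add, zpow_add]
      exact mul_mul_mul_comm ..)
  refine ⟨(MulEquiv.ofBijective f ⟨?_, fun x => ?_⟩).symm⟩
  · rw [injective_iff_map_eq_one]
    intro z hz'
    have h3 : t ^ z.toAdd.1 * (c : A) ^ z.toAdd.2 = 1 := hz'
    have h4 := congrArg τ h3
    rw [map_mul, map_zpow, map_zpow, c.2, one_zpow, mul_one, map_one] at h4
    have h5 := hz _ _ h1 h4
    rw [h5, zpow_zero, one_mul] at h3
    have h6 : c ^ z.toAdd.2 = 1 := Subtype.ext h3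
    have h7 := congrArg κ h6
    rw [map_zpow, map_one] at h7
    have h8 := hz _ _ (fun h => h2 (hκ (h.trans (map_one κ).symm))) h7
    exact Multiplicative.toAdd.injective (Prod.ext h5 h8)
  · obtain ⟨m, n, rfl⟩ := hdecomp x
    exact ⟨Multiplicative.ofAdd (n, m), rfl⟩

end AbelianSubgroups

section AmalgamSubgroups

open Monoid Monoid.PushoutI

variable {ι : Type*} {G : ι → Type*} [∀ i, Group (G i)] {H : Type*} [Group H]
  {φ : ∀ i, H →* G i}

theorem conj_mem_base_of_adj {a b : BSVertex φ} (hab : (bsGraph φ).Adj a b) :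
    ∃ γ : PushoutI φ, ∀ k : PushoutI φ, k • a = a → k • b = b →
      γ⁻¹ * k * γ ∈ (base φ).range := by
  obtain ⟨γ, i, ⟨rfl, -⟩ | ⟨-, rfl⟩⟩ := hab
  · exact ⟨γ, fun k h _ => smul_bsVertex_eq_iff.1 h⟩
  · exact ⟨γ, fun k _ h => smul_bsVertex_eq_iff.1 h⟩

theorem exists_hom_centralizer (hφ : ∀ i, Function.Injective (φ i)) {g : PushoutI φ}
    (hg : ∀ x : BSVertex φ, g • x ≠ x) :
    ∃ (τ : Subgroup.centralizer {g} →* Multiplicative ℤ) (γ : PushoutI φ),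
      ∀ k, τ k = 1 → γ⁻¹ * k * γ ∈ (base φ).range := by
  obtain ⟨τ, a, b, hab, h⟩ := exists_translation_hom (bsGraph_isTree hφ) bsGraph_adj_smul
    even_dist_bsGraph_smul hg
  obtain ⟨γ, hγ⟩ := conj_mem_base_of_adj hab
  exact ⟨τ, γ, fun k hk => hγ k (h k hk).1 (h k hk).2⟩

/-- An abelian subgroup of an amalgamated product is conjugate into a vertex group, or it maps to
`ℤ` with kernel conjugate into the base group. -/
theorem conj_mem_vertexGroup_or_exists_hom (hφ : ∀ i, Function.Injective (φ i))
    (hedge : ∀ (w x y : BSVertex φ) (g k : PushoutI φ), (bsGraph φ).Adj w x →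
      (bsGraph φ).Adj w y → g ≠ 1 → k ≠ 1 → g * k = k * g →
      g • w = w → k • w = w → g • x = x → k • y = y → g • y = y)
    {K : Subgroup (PushoutI φ)} (hK : ∀ x ∈ K, ∀ y ∈ K, x * y = y * x) :
    (∃ (j : Option ι) (γ : PushoutI φ), ∀ k ∈ K, γ⁻¹ * k * γ ∈ vertexGroup φ j) ∨
    ∃ (τ : K →* Multiplicative ℤ) (γ : PushoutI φ),
      ∀ k, τ k = 1 → γ⁻¹ * k * γ ∈ (base φ).range := by
  by_cases hell : ∀ g ∈ K, ∃ x : BSVertex φ, g • x = x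
  · left
    obtain ⟨x, hx⟩ := exists_global_fixed (bsGraph_isTree hφ) bsGraph_adj_smul
      even_dist_bsGraph_smul hedge hK hell
    obtain ⟨j, γ, rfl⟩ := bsVertex_surjective x
    exact ⟨j, γ, fun k hk => smul_bsVertex_eq_iff.1 (hx k hk)⟩
  · right
    push Not at hell
    obtain ⟨g, hgK, hg⟩ := hell
    obtain ⟨τ, γ, h⟩ := exists_hom_centralizer hφ hg
    have hle : K ≤ Subgroup.centralizer {g} := fun k hk =>
      Subgroup.mem_centralizer_singleton_iff.2 (hK k hk g hgK)
    exact ⟨τ.comp (Subgroup.inclusion hle), γ, fun k hk => h _ hk⟩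

theorem isCyclic_of_conj_mem_vertexGroup (hφ : ∀ i, Function.Injective (φ i))
    (hH : AbelianSubgroupsCyclic H) (hG : ∀ i, AbelianSubgroupsCyclic (G i))
    {K : Subgroup (PushoutI φ)} (hK : ∀ x ∈ K, ∀ y ∈ K, x * y = y * x)
    {j : Option ι} {γ : PushoutI φ} (h : ∀ k ∈ K, γ⁻¹ * k * γ ∈ vertexGroup φ j) :
    IsCyclic K := by
  cases j with
  | none => exact hH.isCyclic_of_conj_mem (base φ) (base_injective hφ) γ hK h
  | some i =>
    exact (hG i).isCyclic_of_conj_mem (of i : G i →* PushoutI φ) (of_injective hφ i) γ hK h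

section FreeProduct

variable [Subsingleton H]

theorem eq_one_of_conj_mem_base {k γ : PushoutI φ} (h : γ⁻¹ * k * γ ∈ (base φ).range) :
    k = 1 := by
  obtain ⟨a, ha⟩ := h
  rw [Subsingleton.elim a 1, map_one] at ha
  rw [mul_assoc, eq_comm, inv_mul_eq_one] at ha
  exact mul_eq_right.1 ha.symm

theorem eq_one_of_fixes_adj {a b : BSVertex φ} (hab : (bsGraph φ).Adj a b) {k : PushoutI φ}
    (ha : k • a = a) (hb : k • b = b) : k = 1 := by
  obtain ⟨γ, h⟩ := conj_mem_base_of_adj hab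
  exact eq_one_of_conj_mem_base (h k ha hb)

theorem injective_of_ker_conj_mem_base {K : Subgroup (PushoutI φ)} {τ : K →* Multiplicative ℤ}
    {γ : PushoutI φ} (h : ∀ k, τ k = 1 → γ⁻¹ * k * γ ∈ (base φ).range) :
    Function.Injective τ :=
  (injective_iff_map_eq_one τ).2 fun k hk => Subtype.ext (eq_one_of_conj_mem_base (h k hk))

theorem abelianSubgroupsCyclic_freeProduct (hG : ∀ i, AbelianSubgroupsCyclic (G i)) :
    AbelianSubgroupsCyclic (PushoutI φ) := by
  have hφ : ∀ i, Function.Injective (φ i) := fun i => Function.injective_of_subsingleton _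
  intro K hK
  rcases conj_mem_vertexGroup_or_exists_hom hφ
      (fun w x y g k hx _ hg _ _ hgw _ hgx _ => absurd (eq_one_of_fixes_adj hx hgw hgx) hg) hK with
    ⟨j, γ, h⟩ | ⟨τ, γ, h⟩
  · exact isCyclic_of_conj_mem_vertexGroup hφ (AbelianSubgroupsCyclic.of_isCyclic H) hG hK h
  · exact isCyclic_of_injective τ (injective_of_ker_conj_mem_base h)

theorem centralizersAbelian_freeProduct (hG : ∀ i (x y : G i), x * y = y * x) :
    CentralizersAbelian (PushoutI φ) := by
  have hφ : ∀ i, Function.Injective (φ i) := fun i => Function.injective_of_subsingleton _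
  have hT := bsGraph_isTree hφ
  intro g hg x y hx hy
  have hg1 : g ≠ 1 := fun h => hg (h ▸ IsOfFinOrder.one)
  by_cases hell : ∃ v : BSVertex φ, g • v = v
  · obtain ⟨v, hv⟩ := hell
    have huniq : ∀ w : BSVertex φ, g • w = w → w = v := by
      intro w hw
      by_contra hne
      obtain ⟨z, hz, hz'⟩ := exists_dist_eq_of_le hT.connected v w
        (hT.connected.pos_dist_of_ne (Ne.symm hne))
      exact hg1 (eq_one_of_fixes_adj (SimpleGraph.dist_eq_one_iff_adj.1 hz) hv
        (smul_eq_of_geodesic hT bsGraph_adj_smul hv hw (by rw [hz]; exact hz')))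
    have hfix : ∀ k, Commute g k → k • v = v := by
      intro k hk
      exact huniq _ (by rw [← mul_smul, hk.eq, mul_smul, hv])
    obtain ⟨j, γ, rfl⟩ := bsVertex_surjective v
    have hx' := smul_bsVertex_eq_iff.1 (hfix x hx)
    have hy' := smul_bsVertex_eq_iff.1 (hfix y hy)
    cases j with
    | none =>
      rw [eq_one_of_conj_mem_base hx']
      exact Commute.one_left y
    | some i =>
      obtain ⟨a, ha⟩ := hx'
      obtain ⟨b, hb⟩ := hy'
      have hab : Commute (γ⁻¹ * x * γ) (γ⁻¹ * y * γ) := by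
        rw [← ha, ← hb]
        exact Commute.map (hG i a b) _
      have := hab.map (MulAut.conj γ)
      simpa [mul_assoc] using this
  · push Not at hell
    obtain ⟨τ, γ, h⟩ := exists_hom_centralizer hφ hell
    have hinj := injective_of_ker_conj_mem_base h
    have hmem : ∀ k, Commute g k → k ∈ Subgroup.centralizer {g} := fun k hk =>
      Subgroup.mem_centralizer_singleton_iff.2 hk.symm.eq
    exact congrArg Subtype.val (hinj (a₁ := ⟨x, hmem x hx⟩ * ⟨y, hmem y hy⟩)
      (a₂ := ⟨y, hmem y hy⟩ * ⟨x, hmem x hx⟩) (by rw [map_mul, map_mul, mul_comm]))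

end FreeProduct

end AmalgamSubgroups

section CyclicAmalgam

open Monoid Monoid.PushoutI

variable {ι : Type*} {G : ι → Type*} [∀ i, Group (G i)] {φ : ∀ i, Multiplicative ℤ →* G i}

theorem not_isOfFinOrder_map_generator (hφ : ∀ i, Function.Injective (φ i)) (i : ι) :
    ¬ IsOfFinOrder (φ i (Multiplicative.ofAdd 1)) := by
  rw [(hφ i).isOfFinOrder_iff, isOfFinOrder_iff_zpow_eq_one]
  rintro ⟨n, hn, h⟩
  refine hn ?_
  have := congrArg Multiplicative.toAdd h
  simpa using this

theorem base_eq_of_zpow (i : ι) (h : Multiplicative ℤ) :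
    base φ h = of i (φ i (Multiplicative.ofAdd 1) ^ h.toAdd) := by
  rw [← map_zpow, of_apply_eq_base, ← ofAdd_zsmul]
  simp

theorem smul_eq_of_adj_of_commute (hφ : ∀ i, Function.Injective (φ i))
    (hG : ∀ i, AbelianSubgroupsCyclic (G i)) (hG' : ∀ i, CentralizersAbelian (G i))
    (w x y : BSVertex φ) (g k : PushoutI φ) (hx : (bsGraph φ).Adj w x)
    (hy : (bsGraph φ).Adj w y) (hg : g ≠ 1) (hk : k ≠ 1) (hgk : g * k = k * g)
    (hgw : g • w = w) (_ : k • w = w) (hgx : g • x = x) (hky : k • y = y) : g • y = y := by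
  obtain ⟨γ', i', ⟨rfl, rfl⟩ | ⟨rfl, rfl⟩⟩ := hy
  · exact smul_bsVertex_eq_iff.2 (vertexGroup_none_le φ i' (smul_bsVertex_eq_iff.1 hgw))
  · obtain ⟨γ, i, ⟨h, -⟩ | ⟨h, rfl⟩⟩ := hx
    · exact absurd (congrArg Sigma.fst h) (by simp [bsVertex])
    · obtain rfl : i' = i := Option.some.inj (congrArg Sigma.fst h)
      obtain ⟨a, ha⟩ := bsVertex_eq_iff.1 h.symm
      obtain ⟨s, hs⟩ := smul_bsVertex_eq_iff.1 hgx
      obtain ⟨t, ht⟩ := smul_bsVertex_eq_iff.1 hky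
      obtain rfl : γ' = γ * of i' a := by rw [ha, mul_inv_cancel_left]
      rw [base_eq_of_zpow i'] at hs ht
      have hg' : g = γ * of i' (1 * φ i' (Multiplicative.ofAdd 1) ^ s.toAdd * 1⁻¹) * γ⁻¹ := by
        rw [one_mul, inv_one, mul_one, hs]; group
      have hk' : k = γ * of i' (a * φ i' (Multiplicative.ofAdd 1) ^ t.toAdd * a⁻¹) * γ⁻¹ := by
        rw [map_mul, map_mul, ht, map_inv]; group
      have hs0 : s.toAdd ≠ 0 := fun h0 => hg (by rw [hg', h0]; simp)
      have ht0 : t.toAdd ≠ 0 := fun h0 => hk (by rw [hk', h0]; simp)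
      obtain ⟨m, hm⟩ := conj_zpow_mem_of_commute (hG i') (hG' i')
        (not_isOfFinOrder_map_generator hφ i') (a := 1) (b := a) hs0 ht0 (by
          refine of_injective hφ i' ?_
          have h1 : Commute g k := hgk
          rw [hg', hk'] at h1
          have := h1.map (MulAut.conj γ⁻¹)
          simpa [mul_assoc, commute_iff_eq] using this)
      rw [smul_bsVertex_eq_iff]
      refine ⟨Multiplicative.ofAdd m, ?_⟩
      rw [base_eq_of_zpow i', toAdd_ofAdd, hg', hm]
      simp [mul_assoc]

/-- Abelian subgroups of an amalgamated product of groups over an infinite cyclic group, when the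
factors have cyclic abelian subgroups and abelian centralizers. -/
theorem isCyclic_or_equiv_int_prod_of_pushout (hφ : ∀ i, Function.Injective (φ i))
    (hG : ∀ i, AbelianSubgroupsCyclic (G i)) (hG' : ∀ i, CentralizersAbelian (G i))
    {K : Subgroup (PushoutI φ)} (hK : ∀ x ∈ K, ∀ y ∈ K, x * y = y * x) :
    IsCyclic K ∨ Nonempty (K ≃* Multiplicative (ℤ × ℤ)) := by
  rcases conj_mem_vertexGroup_or_exists_hom hφ (smul_eq_of_adj_of_commute hφ hG hG') hK with
    ⟨j, γ, h⟩ | ⟨τ, γ, h⟩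
  · exact Or.inl
      (isCyclic_of_conj_mem_vertexGroup hφ (AbelianSubgroupsCyclic.of_isCyclic _) hG hK h)
  · let c : τ.ker →* (base φ).range :=
      ((MulAut.conj γ⁻¹).toMonoidHom.comp (K.subtype.comp τ.ker.subtype)).codRestrict
        (base φ).range (fun k => by simpa using h k k.2)
    have hc : Function.Injective c := by
      intro x y hxy
      have h1 := (MulAut.conj γ⁻¹).injective (congrArg Subtype.val hxy)
      exact Subtype.ext (Subtype.ext h1)
    let _ : CommGroup K :=
      { (inferInstance : Group K) with mul_comm := fun x y => Subtype.ext (hK x x.2 y y.2) }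
    exact isCyclic_or_equiv_int_prod τ
      ((MonoidHom.ofInjective (base_injective hφ)).symm.toMonoidHom.comp c)
      ((MonoidHom.ofInjective (base_injective hφ)).symm.injective.comp hc)

end CyclicAmalgam

section Presentations

open Monoid Monoid.PushoutI

theorem injective_zpowersHom {S : Type*} [Group S] {g : S} (hg : ¬ IsOfFinOrder g) :
    Function.Injective (zpowersHom S g) := by
  rw [injective_iff_map_eq_one]
  intro n hn
  by_contra hne
  exact hg (isOfFinOrder_iff_zpow_eq_one.2 ⟨n.toAdd, hne, by simpa using hn⟩)

/-- Two homomorphisms out of a free group agree on a word if they agree on its letters. -/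
theorem lift_eq_of_forall_mem_toWord {α S : Type*} [DecidableEq α] [Group S] {f f' : α → S}
    {w : FreeGroup α} (h : ∀ x ∈ w.toWord, f x.1 = f' x.1) :
    FreeGroup.lift f w = FreeGroup.lift f' w := by
  rw [← FreeGroup.mk_toWord (x := w), FreeGroup.lift_mk, FreeGroup.lift_mk]
  congr 1
  refine List.map_congr_left fun x hx => ?_
  rw [h x hx]

/-- A group presented by powers of the generators embeds in a free product of cyclic groups. -/
theorem exists_injective_hom_freeProduct {ι : Type*} (e : ι → ℕ) {R : Set (FreeGroup ι)}
    (hR : R = {w | ∃ i, w = FreeGroup.of i ^ e i}) :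
    ∃ f : PresentedGroup R →*
        PushoutI (fun i => (1 : Unit →* Multiplicative (ZMod (e i)))),
      Function.Injective f := by
  have hrel : ∀ i, PresentedGroup.mk R (FreeGroup.of i) ^ e i = 1 := by
    intro i
    rw [← map_pow]
    exact PresentedGroup.one_of_mem (hR ▸ ⟨i, rfl⟩)
  let f : PresentedGroup R →* PushoutI (fun i => (1 : Unit →* Multiplicative (ZMod (e i)))) :=
    PresentedGroup.toGroup
      (f := fun i => of (φ := fun i => (1 : Unit →* Multiplicative (ZMod (e i)))) i
        (Multiplicative.ofAdd 1)) (by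
      subst hR
      rintro _ ⟨i, rfl⟩
      rw [map_pow, FreeGroup.lift_apply_of, ← map_pow, ← ofAdd_nsmul]
      simp)
  let c : ∀ i, Multiplicative (ZMod (e i)) →* PresentedGroup R := fun i =>
    AddMonoidHom.toMultiplicativeLeft (ZMod.lift (e i)
      ⟨(zmultiplesHom _) (Additive.ofMul (PresentedGroup.mk R (FreeGroup.of i))), by
        simpa using congrArg Additive.ofMul (hrel i)⟩)
  let g : PushoutI (fun i => (1 : Unit →* Multiplicative (ZMod (e i)))) →* PresentedGroup R :=
    PushoutI.lift c 1 (fun i => by ext; simp)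
  have hgf : g.comp f = MonoidHom.id _ := by
    refine PresentedGroup.ext fun i => ?_
    have h1 : f (PresentedGroup.of i) = of i (Multiplicative.ofAdd 1) := PresentedGroup.toGroup.of _
    rw [MonoidHom.comp_apply, h1, PushoutI.lift_of]
    have h2 := ZMod.lift_coe (e i) (A := Additive (PresentedGroup R))
      ⟨(zmultiplesHom _) (Additive.ofMul (PresentedGroup.mk R (FreeGroup.of i))), by
        simpa using congrArg Additive.ofMul (hrel i)⟩ 1
    have h3 := congrArg Additive.toMul h2
    have h4 : (Multiplicative.ofAdd 1 : Multiplicative (ZMod (e i))) =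
        Multiplicative.ofAdd ((1 : ℤ) : ZMod (e i)) := by rw [Int.cast_one]
    rw [h4]
    exact h3.trans (by simp [PresentedGroup.of])
  exact ⟨f, Function.LeftInverse.injective (g := g) fun x => DFunLike.congr_fun hgf x⟩

theorem abelianSubgroupsCyclic_and_centralizersAbelian_of_powers {ι : Type*} (e : ι → ℕ)
    {R : Set (FreeGroup ι)} (hR : R = {w | ∃ i, w = FreeGroup.of i ^ e i}) :
    AbelianSubgroupsCyclic (PresentedGroup R) ∧ CentralizersAbelian (PresentedGroup R) := by
  obtain ⟨f, hf⟩ := exists_injective_hom_freeProduct e hR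
  exact ⟨(abelianSubgroupsCyclic_freeProduct fun i =>
      AbelianSubgroupsCyclic.of_isCyclic _).of_injective f hf,
    (centralizersAbelian_freeProduct fun i => mul_comm).of_injective f hf⟩

namespace FTypeBase

variable (D : FTypeBase)

theorem rels1_eq : D.rels1 =
    {w | ∃ i : Fin D.n, w = FreeGroup.of i ^ (if (i : ℕ) < D.p then D.e i else 1)} := by
  ext w
  constructor
  · rintro (⟨i, hi, rfl⟩ | ⟨i, hi, rfl⟩)
    · exact ⟨i, by rw [if_pos hi]⟩
    · exact ⟨i, by rw [if_neg (by omega), pow_one]⟩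
  · rintro ⟨i, rfl⟩
    by_cases hi : (i : ℕ) < D.p
    · exact Or.inl ⟨i, hi, by rw [if_pos hi]⟩
    · exact Or.inr ⟨i, by omega, by rw [if_neg hi, pow_one]⟩

theorem rels2_eq : D.rels2 =
    {w | ∃ i : Fin D.n, w = FreeGroup.of i ^ (if (i : ℕ) < D.p then 1 else D.e i)} := by
  ext w
  constructor
  · rintro (⟨i, hi, rfl⟩ | ⟨i, hi, rfl⟩)
    · exact ⟨i, by rw [if_neg (by omega)]⟩
    · exact ⟨i, by rw [if_pos hi, pow_one]⟩
  · rintro ⟨i, rfl⟩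
    by_cases hi : (i : ℕ) < D.p
    · exact Or.inr ⟨i, hi, by rw [if_pos hi, pow_one]⟩
    · exact Or.inl ⟨i, by omega, by rw [if_neg hi]⟩

/-- The two factors of an F-type group, indexed by `Bool`. -/
abbrev factorRels : Bool → Set (FreeGroup (Fin D.n))
  | true => D.rels1
  | false => D.rels2

/-- The inclusions of the amalgamated subgroup into the two factors. -/
def amalgHom : ∀ b, Multiplicative ℤ →* PresentedGroup (D.factorRels b)
  | true => zpowersHom D.Gp1 D.imgU1⁻¹
  | false => zpowersHom D.Gp2 D.imgV2

theorem amalgHom_injective (hU : ¬ IsOfFinOrder D.imgU1) (hV : ¬ IsOfFinOrder D.imgV2) (b : Bool) :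
    Function.Injective (D.amalgHom b) := by
  cases b with
  | true => exact injective_zpowersHom (by rwa [isOfFinOrder_inv_iff])
  | false => exact injective_zpowersHom hV

/-- The image of a generator in the amalgamated product. -/
def genImage (i : Fin D.n) : PushoutI D.amalgHom :=
  if (i : ℕ) < D.p then of (φ := D.amalgHom) true (PresentedGroup.of i)
  else of (φ := D.amalgHom) false (PresentedGroup.of i)

theorem lift_genImage_U (hU : ∀ x ∈ D.U.toWord, (x.1 : ℕ) < D.p) :
    FreeGroup.lift D.genImage D.U = of (φ := D.amalgHom) true D.imgU1 := by
  rw [lift_eq_of_forall_mem_toWord (f' := fun i =>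
    of (φ := D.amalgHom) true (PresentedGroup.of i)) fun x hx => if_pos (hU x hx)]
  refine DFunLike.congr_fun (f := FreeGroup.lift _)
    (g := (of (φ := D.amalgHom) true).comp (PresentedGroup.mk D.rels1)) ?_ D.U
  ext i
  simp [PresentedGroup.of]

theorem lift_genImage_V (hV : ∀ x ∈ D.V.toWord, D.p ≤ (x.1 : ℕ)) :
    FreeGroup.lift D.genImage D.V = of (φ := D.amalgHom) false D.imgV2 := by
  rw [lift_eq_of_forall_mem_toWord (f' := fun i =>
    of (φ := D.amalgHom) false (PresentedGroup.of i)) fun x hx => if_neg (not_lt.2 (hV x hx))]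
  refine DFunLike.congr_fun (f := FreeGroup.lift _)
    (g := (of (φ := D.amalgHom) false).comp (PresentedGroup.mk D.rels2)) ?_ D.V
  ext i
  simp [PresentedGroup.of]

theorem of_imgU1_mul_of_imgV2 :
    of (φ := D.amalgHom) true D.imgU1 * of (φ := D.amalgHom) false D.imgV2 = 1 := by
  have h1 : D.imgU1 = D.amalgHom true (Multiplicative.ofAdd (-1)) := by
    simp [amalgHom]
  have h2 : D.imgV2 = D.amalgHom false (Multiplicative.ofAdd 1) := by
    simp [amalgHom]
  rw [h1, h2, of_apply_eq_base, of_apply_eq_base, ← map_mul, ← ofAdd_add]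
  simp

theorem lift_genImage_rels (hU : ∀ x ∈ D.U.toWord, (x.1 : ℕ) < D.p)
    (hV : ∀ x ∈ D.V.toWord, D.p ≤ (x.1 : ℕ)) :
    ∀ r ∈ D.rels, FreeGroup.lift D.genImage r = 1 := by
  rintro _ (⟨i, rfl⟩ | rfl)
  · rw [map_pow, FreeGroup.lift_apply_of, genImage]
    split_ifs with hi
    · rw [← map_pow]
      have : (PresentedGroup.of i : D.Gp1) ^ D.e i = 1 :=
        PresentedGroup.one_of_mem (rels := D.rels1) (Or.inl ⟨i, hi, rfl⟩)
      exact (congrArg _ this).trans (map_one _)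
    · rw [← map_pow]
      have : (PresentedGroup.of i : D.Gp2) ^ D.e i = 1 :=
        PresentedGroup.one_of_mem (rels := D.rels2) (Or.inl ⟨i, by omega, rfl⟩)
      exact (congrArg _ this).trans (map_one _)
  · rw [map_mul, D.lift_genImage_U hU, D.lift_genImage_V hV, of_imgU1_mul_of_imgV2]

theorem of_pow_eq_one (i : Fin D.n) : (PresentedGroup.of i : D.Gp) ^ D.e i = 1 :=
  PresentedGroup.one_of_mem (rels := D.rels) (Or.inl ⟨i, rfl⟩)

/-- The homomorphism from the first factor to the F-type group. -/
def fromGp1 : D.Gp1 →* D.Gp :=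
  PresentedGroup.toGroup (rels := D.rels1)
    (f := fun i : Fin D.n => if (i : ℕ) < D.p then PresentedGroup.of i else 1) (by
    rintro _ (⟨i, hi, rfl⟩ | ⟨i, hi, rfl⟩)
    · rw [map_pow, FreeGroup.lift_apply_of, if_pos hi, of_pow_eq_one]
    · rw [FreeGroup.lift_apply_of, if_neg (by omega)])

/-- The homomorphism from the second factor to the F-type group. -/
def fromGp2 : D.Gp2 →* D.Gp :=
  PresentedGroup.toGroup (rels := D.rels2)
    (f := fun i : Fin D.n => if (i : ℕ) < D.p then 1 else PresentedGroup.of i) (by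
    rintro _ (⟨i, hi, rfl⟩ | ⟨i, hi, rfl⟩)
    · rw [map_pow, FreeGroup.lift_apply_of, if_neg (by omega), of_pow_eq_one]
    · rw [FreeGroup.lift_apply_of, if_pos hi])

theorem lift_of_eq_mk (w : FreeGroup (Fin D.n)) :
    FreeGroup.lift (fun i => (PresentedGroup.of i : D.Gp)) w = PresentedGroup.mk D.rels w := by
  refine DFunLike.congr_fun (f := FreeGroup.lift _) (g := PresentedGroup.mk D.rels) ?_ w
  ext i
  simp [PresentedGroup.of]

theorem fromGp1_imgU1 (hU : ∀ x ∈ D.U.toWord, (x.1 : ℕ) < D.p) :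
    D.fromGp1 D.imgU1 = PresentedGroup.mk D.rels D.U := by
  rw [← lift_of_eq_mk]
  exact lift_eq_of_forall_mem_toWord
    (f := fun i : Fin D.n => if (i : ℕ) < D.p then (PresentedGroup.of i : D.Gp) else 1)
    fun x hx => if_pos (hU x hx)

theorem fromGp2_imgV2 (hV : ∀ x ∈ D.V.toWord, D.p ≤ (x.1 : ℕ)) :
    D.fromGp2 D.imgV2 = PresentedGroup.mk D.rels D.V := by
  rw [← lift_of_eq_mk]
  exact lift_eq_of_forall_mem_toWord
    (f := fun i : Fin D.n => if (i : ℕ) < D.p then 1 else (PresentedGroup.of i : D.Gp))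
    fun x hx => if_neg (not_lt.2 (hV x hx))

/-- An F-type group embeds in the amalgamated product of its two factors. -/
theorem exists_injective_hom_pushout (hU : ∀ x ∈ D.U.toWord, (x.1 : ℕ) < D.p)
    (hV : ∀ x ∈ D.V.toWord, D.p ≤ (x.1 : ℕ)) :
    ∃ f : D.Gp →* PushoutI D.amalgHom, Function.Injective f := by
  let f : D.Gp →* PushoutI D.amalgHom := PresentedGroup.toGroup (D.lift_genImage_rels hU hV)
  let c : ∀ b, PresentedGroup (D.factorRels b) →* D.Gp
    | true => D.fromGp1
    | false => D.fromGp2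
  have hUV : PresentedGroup.mk D.rels D.U * PresentedGroup.mk D.rels D.V = 1 := by
    rw [← map_mul]
    exact PresentedGroup.one_of_mem (Or.inr rfl)
  have hc : ∀ b, (c b).comp (D.amalgHom b) = zpowersHom D.Gp (PresentedGroup.mk D.rels D.V) := by
    intro b
    ext
    cases b with
    | true =>
      have : D.fromGp1 D.imgU1⁻¹ = PresentedGroup.mk D.rels D.V := by
        rw [map_inv, D.fromGp1_imgU1 hU, inv_eq_iff_mul_eq_one, hUV]
      simpa [c, amalgHom] using this
    | false => simpa [c, amalgHom] using D.fromGp2_imgV2 hV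
  let g : PushoutI D.amalgHom →* D.Gp := PushoutI.lift c _ hc
  have hgf : g.comp f = MonoidHom.id _ := by
    refine PresentedGroup.ext fun i => ?_
    have h1 : f (PresentedGroup.of i) = D.genImage i := PresentedGroup.toGroup.of _
    rw [MonoidHom.comp_apply, h1, genImage, MonoidHom.id_apply]
    split_ifs with hi
    · exact (PushoutI.lift_of (φ := D.amalgHom) c _ hc (PresentedGroup.of i)).trans
        ((PresentedGroup.toGroup.of _).trans (if_pos hi))
    · exact (PushoutI.lift_of (φ := D.amalgHom) c _ hc (PresentedGroup.of i)).trans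
        ((PresentedGroup.toGroup.of _).trans (if_neg hi))
  exact ⟨f, Function.LeftInverse.injective (g := g) fun x => DFunLike.congr_fun hgf x⟩

end FTypeBase

end Presentations

/-- Every abelian subgroup of a group of F-type is cyclic or free abelian of
rank `2`. -/
theorem fType_abelian_subgroups (G : Type*) [Group G] (hG : IsFTypeGroup G)
    (H : Subgroup G) (hH : ∀ x ∈ H, ∀ y ∈ H, x * y = y * x) :
    IsCyclic H ∨ Nonempty (H ≃* Multiplicative (ℤ × ℤ)) := by
  obtain ⟨D, ⟨-, -, -, -, hU, hV, -, -, hU', hV', -, -⟩, ⟨E⟩⟩ := hG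
  obtain ⟨f, hf⟩ := D.exists_injective_hom_pushout hU hV
  let F := f.comp E.toMonoidHom
  have hF : Function.Injective F := hf.comp E.injective
  have hfac : ∀ b, AbelianSubgroupsCyclic (PresentedGroup (D.factorRels b)) ∧
      CentralizersAbelian (PresentedGroup (D.factorRels b))
    | true => abelianSubgroupsCyclic_and_centralizersAbelian_of_powers _ D.rels1_eq
    | false => abelianSubgroupsCyclic_and_centralizersAbelian_of_powers _ D.rels2_eq
  have e : H ≃* H.map F := H.equivMapOfInjective F hF
  rcases isCyclic_or_equiv_int_prod_of_pushout (D.amalgHom_injective hU' hV')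
      (fun b => (hfac b).1) (fun b => (hfac b).2) (K := H.map F) (by
        rintro _ ⟨x, hx, rfl⟩ _ ⟨y, hy, rfl⟩
        rw [← map_mul, hH x hx y hy, map_mul]) with h | h
  · exact Or.inl (e.isCyclic.2 h)
  · exact Or.inr (h.map e.trans)

end FPaper
end

section
/- Let G be a group of F-type. Then either G contains a free subgroup of rank 2, or G is solvable and isomorphic to a group with one of the following presentations: H_1 = ⟨a,b ∣ a²b² = 1⟩, H_2 = ⟨a,b,c ∣ a² = b² = abc² = 1⟩, or H_3 = ⟨a,b,c,d ∣ a² = b² = c² = d² = abcd = 1⟩. -/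
open scoped MatrixGroups

namespace FPaper

/-- The relator set of `H₁ = ⟨a, b ∣ a²b² = 1⟩`. -/
def relsH1 : Set (FreeGroup (Fin 2)) :=
  {FreeGroup.of 0 ^ 2 * FreeGroup.of 1 ^ 2}

/-- The relator set of `H₂ = ⟨a, b, c ∣ a² = b² = abc² = 1⟩`. -/
def relsH2 : Set (FreeGroup (Fin 3)) :=
  {FreeGroup.of 0 ^ 2, FreeGroup.of 1 ^ 2,
    FreeGroup.of 0 * FreeGroup.of 1 * FreeGroup.of 2 ^ 2}

/-- The relator set of `H₃ = ⟨a, b, c, d ∣ a² = b² = c² = d² = abcd = 1⟩`. -/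
def relsH3 : Set (FreeGroup (Fin 4)) :=
  {FreeGroup.of 0 ^ 2, FreeGroup.of 1 ^ 2, FreeGroup.of 2 ^ 2, FreeGroup.of 3 ^ 2,
    FreeGroup.of 0 * FreeGroup.of 1 * FreeGroup.of 2 * FreeGroup.of 3}

section PingPong

/-- Ping-pong with translates of a single set: if `z` and `z⁻¹` map the complement of `W` into `W`
and the translates of `W` by the elements `c p` are pairwise disjoint, then the elements
`c (i, true) * z * (c (i, false))⁻¹` freely generate a free group. -/
theorem injective_lift_of_translates.{u, v} {ι G : Type u} {α : Type v} [Nontrivial ι] [Group G] [MulAction G α]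
    (W : Set α) (hW : W.Nonempty) (z : G) (c : ι × Bool → G)
    (hz : ∀ w ∉ W, z • w ∈ W) (hz' : ∀ w ∉ W, z⁻¹ • w ∈ W)
    (hc : ∀ p q : ι × Bool, p ≠ q → ∀ w ∈ W, ((c p)⁻¹ * c q) • w ∉ W) :
    Function.Injective
      (FreeGroup.lift fun i : ι => c (i, true) * z * (c (i, false))⁻¹) := by
  have hdisj : ∀ p q : ι × Bool, p ≠ q → Disjoint {a : α | (c p)⁻¹ • a ∈ W} {a : α | (c q)⁻¹ • a ∈ W} := by
    intro p q hpq
    rw [Set.disjoint_left]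
    intro a ha hb
    have := hc p q hpq _ hb
    rw [smul_smul, mul_inv_cancel_right] at this
    exact this ha
  refine FreeGroup.injective_lift_of_ping_pong (fun i => c (i, true) * z * (c (i, false))⁻¹)
    (fun i => {a | (c (i, true))⁻¹ • a ∈ W}) (fun i => {a | (c (i, false))⁻¹ • a ∈ W})
    ?_ ?_ ?_ ?_ ?_ ?_
  · intro i
    obtain ⟨w, hw⟩ := hW
    exact ⟨c (i, true) • w, by simpa using hw⟩
  · intro i j hij
    exact hdisj _ _ (by simpa using hij)
  · intro i j hij
    exact hdisj _ _ (by simpa using hij)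
  · intro i j
    exact hdisj _ _ (by simp)
  · rintro i _ ⟨a, ha, rfl⟩
    simpa [smul_smul, mul_assoc] using hz _ ha
  · rintro i _ ⟨a, ha, rfl⟩
    simpa [smul_smul, mul_assoc] using hz' _ ha

open Monoid Monoid.PushoutI in
/-- An amalgamated product in which the amalgamated subgroup has at least three cosets in one factor
and is proper in another contains a free subgroup of rank two. -/
theorem exists_injective_lift_pushoutI {ι H : Type} {G : ι → Type} [∀ i, Group (G i)] [Group H]
    (φ : ∀ i, H →* G i) (hφ : ∀ i, Function.Injective (φ i)) {i j : ι} (hij : i ≠ j)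
    {x y : G i} {z : G j} (hx : x ∉ (φ i).range) (hy : y ∉ (φ i).range)
    (hxy : x⁻¹ * y ∉ (φ i).range) (hz : z ∉ (φ j).range) :
    ∃ a : Fin 2 → PushoutI φ, Function.Injective (FreeGroup.lift a) := by
  classical
  obtain ⟨d⟩ := NormalWord.transversal_nonempty φ hφ
  have step : ∀ {k : ι} {g : G k} (w : NormalWord d), g ∉ (φ k).range → w.fstIdx ≠ some k →
      ((of k g : PushoutI φ) • w).fstIdx = some k := by
    intro k g w hg hw
    rw [← NormalWord.cons_eq_smul g w hw hg]
    simp [NormalWord.cons, CoprodI.Word.fstIdx, CoprodI.Word.cons]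
  have hne : ∀ {w : NormalWord d} {k l : ι}, k ≠ l → w.fstIdx = some k → w.fstIdx ≠ some l := by
    intro w k l hkl hw h
    exact hkl (Option.some.inj (hw.symm.trans h))
  have hinv : ∀ {k : ι} {g : G k}, g ∉ (φ k).range → g⁻¹ ∉ (φ k).range := by
    intro k g hg h
    exact hg (by simpa using h)
  have hyx : y⁻¹ * x ∉ (φ i).range := by
    have := hinv hxy
    rwa [mul_inv_rev, inv_inv] at this
  let X : PushoutI φ := of i x
  let Y : PushoutI φ := of i y
  let Z : PushoutI φ := of j z
  let c : Fin 2 × Bool → PushoutI φ := fun p => (if p.1 = 0 then 1 else Z) * (if p.2 then X else Y)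
  let W : Set (NormalWord d) := {w | w.fstIdx = some j}
  have single : ∀ {g : G i}, g ∉ (φ i).range → ∀ w ∈ W, (of i g : PushoutI φ) • w ∉ W :=
    fun hg w hw => hne hij (step w hg (hne hij.symm hw))
  have triple : ∀ {g g' : G i} {h : G j}, g ∉ (φ i).range → g' ∉ (φ i).range → h ∉ (φ j).range →
      ∀ w ∈ W, (of i g * of j h * of i g' : PushoutI φ) • w ∉ W := by
    intro g g' h hg hg' hh w hw
    rw [mul_smul, mul_smul]
    exact single hg _ (step _ hh (single hg' w hw))
  refine ⟨_, injective_lift_of_translates W ⟨Z • NormalWord.empty, ?_⟩ Z c ?_ ?_ ?_⟩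
  · exact step _ hz (by simp [CoprodI.Word.fstIdx])
  · intro w hw
    exact step w hz hw
  · intro w hw
    have := step w (hinv hz) hw
    rwa [map_inv] at this
  · have key : ∀ (b b' : Bool) (w : NormalWord d), w ∈ W → ∀ k k' : Fin 2, (k, b) ≠ (k', b') →
        ((c (k, b))⁻¹ * c (k', b')) • w ∉ W := by
      intro b b' w hw k k' hne
      let g : Bool → G i := fun b => if b then x else y
      have hg : ∀ b, g b ∉ (φ i).range := by
        intro b
        cases b
        · exact hy
        · exact hx
      have hc : ∀ k b, c (k, b) = (if k = 0 then 1 else of j z) * of i (g b) := by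
        intro k b
        cases b <;> rfl
      have hgg : b ≠ b' → (g b)⁻¹ * g b' ∉ (φ i).range := by
        intro hb
        cases b <;> cases b'
        · exact absurd rfl hb
        · exact hyx
        · exact hxy
        · exact absurd rfl hb
      by_cases hk : k = k'
      · subst hk
        have hb : b ≠ b' := fun h => hne (by rw [h])
        have e : (c (k, b))⁻¹ * c (k, b') = of i ((g b)⁻¹ * g b') := by
          rw [hc, hc, map_mul, map_inv]
          group
        rw [e]
        exact single (hgg hb) w hw
      · have h01 : (k = 0 ∧ k' = 1) ∨ (k = 1 ∧ k' = 0) := by omega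
        rcases h01 with ⟨rfl, rfl⟩ | ⟨rfl, rfl⟩
        · have e : (c (0, b))⁻¹ * c (1, b') = of i (g b)⁻¹ * of j z * of i (g b') := by
            rw [hc, hc, map_inv]
            simp [mul_assoc]
          rw [e]
          exact triple (hinv (hg b)) (hg b') hz w hw
        · have e : (c (1, b))⁻¹ * c (0, b') = of i (g b)⁻¹ * of j z⁻¹ * of i (g b') := by
            rw [hc, hc, map_inv, map_inv]
            simp
          rw [e]
          exact triple (hinv (hg b)) (hg b') (hinv hz) w hw
    rintro ⟨k, b⟩ ⟨k', b'⟩ hne w hw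
    exact key b b' w hw k k' hne

end PingPong

section CyclicFactors

variable {ι : Type*}

/-- Relators presenting the free product of the cyclic groups `⟨a_i ∣ a_i ^ e_i⟩` over the indices
satisfying `P`; the other generators are killed. -/
def cyclicRels (e : ι → ℕ) (P : ι → Prop) : Set (FreeGroup ι) :=
  {w | ∃ i, P i ∧ w = FreeGroup.of i ^ e i} ∪ {w | ∃ i, ¬ P i ∧ w = FreeGroup.of i}

variable {e : ι → ℕ} {P : ι → Prop}

theorem cyclicRels_of_pow {i : ι} (hi : P i) :
    (PresentedGroup.of i : PresentedGroup (cyclicRels e P)) ^ e i = 1 := by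
  rw [PresentedGroup.of, ← map_pow]
  exact PresentedGroup.one_of_mem (Or.inl ⟨i, hi, rfl⟩)

theorem cyclicRels_of_eq_one {i : ι} (hi : ¬ P i) :
    (PresentedGroup.of i : PresentedGroup (cyclicRels e P)) = 1 :=
  PresentedGroup.one_of_mem (Or.inr ⟨i, hi, rfl⟩)

theorem lift_eq_of_agree_on_letters {T : Type*} [Group T] [DecidableEq ι] {f g : ι → T}
    {w : FreeGroup ι} (h : ∀ x ∈ w.toWord, f x.1 = g x.1) :
    FreeGroup.lift f w = FreeGroup.lift g w := by
  rw [← FreeGroup.mk_toWord (x := w), FreeGroup.lift_mk, FreeGroup.lift_mk]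
  congr 1
  refine List.map_congr_left fun x hx => ?_
  rw [h x hx]

/-- A free product of cyclics maps to any group by a compatible choice of images. -/
theorem exists_hom_of_cyclicRels {T : Type*} [Group T] (f : ι → T)
    (hf : ∀ i, P i → f i ^ e i = 1) :
    ∃ F : PresentedGroup (cyclicRels e P) →* T, (∀ i, P i → F (.of i) = f i) ∧
      ∀ [DecidableEq ι] (w : FreeGroup ι), (∀ x ∈ w.toWord, P x.1) →
        F (PresentedGroup.mk _ w) = FreeGroup.lift f w := by
  classical
  have h : ∀ r ∈ cyclicRels e P, FreeGroup.lift (fun i => if P i then f i else 1) r = 1 := by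
    rintro r (⟨i, hi, rfl⟩ | ⟨i, hi, rfl⟩)
    · simp [hi, hf i hi]
    · simp [hi]
  refine ⟨PresentedGroup.toGroup h, fun i hi => by simp [hi], fun w hw => ?_⟩
  exact lift_eq_of_agree_on_letters fun x hx => by simp [hw x hx]

theorem lift_eq_mul_of_mk_eq [DecidableEq ι] {T : Type*} [Group T] (f : ι → T)
    (hf : ∀ i, P i → f i ^ e i = 1) {U : FreeGroup ι} (hU : ∀ x ∈ U.toWord, P x.1) {i j : ι}
    (hi : P i) (hj : P j)
    (h : PresentedGroup.mk (cyclicRels e P) U = PresentedGroup.of i * PresentedGroup.of j) :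
    FreeGroup.lift f U = f i * f j := by
  obtain ⟨F, hF, hF'⟩ := exists_hom_of_cyclicRels f hf
  rw [← hF' U hU, h, map_mul, hF i hi, hF j hj]

end CyclicFactors

section CyclicNormal

variable {G : Type*} [Group G]

theorem zpowers_normal_of_generators {S : Set G} (hS : Subgroup.closure S = ⊤) {z : G}
    (h : ∀ g ∈ S, g * z * g⁻¹ = z ∨ g * z * g⁻¹ = z⁻¹) : (Subgroup.zpowers z).Normal := by
  have key : ∀ g : G, g * z * g⁻¹ = z ∨ g * z * g⁻¹ = z⁻¹ := by
    intro g
    have hg : g ∈ Subgroup.closure S := hS ▸ Subgroup.mem_top g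
    induction hg using Subgroup.closure_induction with
    | mem x hx => exact h x hx
    | one => simp
    | mul x y _ _ hx hy =>
      have e : x * y * z * (x * y)⁻¹ = x * (y * z * y⁻¹) * x⁻¹ := by group
      rcases hx with hx | hx <;> rcases hy with hy | hy <;> rw [e, hy] <;>
        simp [← conj_inv, hx]
    | inv x _ hx =>
      rcases hx with hx | hx
      · left
        nth_rewrite 1 [← hx]
        group
      · right
        have e : x * z⁻¹ * x⁻¹ = z := by rw [← conj_inv, hx, inv_inv]
        nth_rewrite 1 [← e]
        group
  refine ⟨?_⟩
  rintro _ ⟨k, rfl⟩ g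
  change g * z ^ k * g⁻¹ ∈ _
  rw [← conj_zpow]
  rcases key g with hg | hg <;> rw [hg]
  · exact Subgroup.zpow_mem_zpowers z k
  · exact zpow_mem (inv_mem (Subgroup.mem_zpowers z)) k

theorem isSolvable_of_zpowers_normal_of_quotient_zpowers {z : G} [(Subgroup.zpowers z).Normal]
    (h : Group.IsSolvable (G ⧸ Subgroup.zpowers z)) : Group.IsSolvable G :=
  (Group.isSolvable_iff_subgroup_quotient (Subgroup.zpowers z)).2
    ⟨Group.isSolvable_of_comm fun a b => mul_comm' a b, h⟩

/-- If `a² = b² = 1`, then conjugation by `a` and by `b` inverts `ab`. -/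
theorem conj_mul_of_involutions {a b : G} (ha : a ^ 2 = 1) (hb : b ^ 2 = 1) :
    a * (a * b) * a⁻¹ = (a * b)⁻¹ ∧ b * (a * b) * b⁻¹ = (a * b)⁻¹ := by
  have ha' : a⁻¹ = a := inv_eq_of_mul_eq_one_left (by rw [← sq, ha])
  have hb' : b⁻¹ = b := inv_eq_of_mul_eq_one_left (by rw [← sq, hb])
  constructor
  · rw [mul_inv_rev, ha', hb', ← mul_assoc, ← sq, ha, one_mul]
  · rw [mul_inv_rev, ha', hb', mul_assoc, mul_assoc, ← sq, hb, mul_one]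

theorem isSolvable_of_two_involutions {s t : G} (hs : s ^ 2 = 1) (ht : t ^ 2 = 1)
    (hG : Subgroup.closure {s, t} = ⊤) : Group.IsSolvable G := by
  have : (Subgroup.zpowers (s * t)).Normal := by
    refine zpowers_normal_of_generators hG ?_
    rintro g (rfl | rfl) <;> right
    · exact (conj_mul_of_involutions hs ht).1
    · exact (conj_mul_of_involutions hs ht).2
  refine isSolvable_of_zpowers_normal_of_quotient_zpowers (z := s * t) ?_
  let q := QuotientGroup.mk' (Subgroup.zpowers (s * t))
  have hq : Subgroup.zpowers (q s) = ⊤ := by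
    rw [eq_top_iff, ← MonoidHom.range_eq_top.2 (QuotientGroup.mk'_surjective _),
      MonoidHom.range_eq_map, ← hG, MonoidHom.map_closure, Subgroup.closure_le]
    rintro _ ⟨g, (rfl | rfl), rfl⟩
    · exact Subgroup.mem_zpowers _
    · have h1 : q s * q g = 1 := by
        rw [← map_mul]
        exact (QuotientGroup.eq_one_iff _).2 (Subgroup.mem_zpowers _)
      rw [SetLike.mem_coe, show QuotientGroup.mk' _ g = (q s)⁻¹ from eq_inv_of_mul_eq_one_right h1]
      exact inv_mem (Subgroup.mem_zpowers _)
  have : IsCyclic (G ⧸ Subgroup.zpowers (s * t)) :=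
    ⟨q s, fun x => by
      change x ∈ Subgroup.zpowers (q s)
      rw [hq]
      exact Subgroup.mem_top x⟩
  exact Group.isSolvable_of_comm fun a b => mul_comm' a b

/-- A group is solvable if it has a normal cyclic subgroup modulo which it is generated by two
involutions. -/
theorem isSolvable_of_cyclic_by_dihedral {S : Set G} (hS : Subgroup.closure S = ⊤) {z s t : G}
    (h : ∀ g ∈ S, g * z * g⁻¹ = z ∨ g * z * g⁻¹ = z⁻¹)
    (hs : s ^ 2 ∈ Subgroup.zpowers z) (ht : t ^ 2 ∈ Subgroup.zpowers z)
    (hst : ∀ g ∈ S, s⁻¹ * g ∈ Subgroup.zpowers z ∨ t⁻¹ * g ∈ Subgroup.zpowers z) :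
    Group.IsSolvable G := by
  have := zpowers_normal_of_generators hS h
  refine isSolvable_of_zpowers_normal_of_quotient_zpowers (z := z) ?_
  let q := QuotientGroup.mk' (Subgroup.zpowers z)
  refine isSolvable_of_two_involutions (s := q s) (t := q t) ?_ ?_ ?_
  · rw [← map_pow]
    exact (QuotientGroup.eq_one_iff _).2 hs
  · rw [← map_pow]
    exact (QuotientGroup.eq_one_iff _).2 ht
  · rw [eq_top_iff, ← MonoidHom.range_eq_top.2 (QuotientGroup.mk'_surjective _),
      MonoidHom.range_eq_map, ← hS, MonoidHom.map_closure, Subgroup.closure_le]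
    rintro _ ⟨g, hg, rfl⟩
    rcases hst g hg with h | h
    · have e : q s = q g := QuotientGroup.eq.2 h
      exact Subgroup.subset_closure (Or.inl e.symm)
    · have e : q t = q g := QuotientGroup.eq.2 h
      exact Subgroup.subset_closure (Or.inr e.symm)

end CyclicNormal

section SmallIndex

variable {K : Type*} [Group K] {u : K}

/-- The subgroup `⟨u⟩` has at least three left cosets. -/
def HasThreeCosets (u : K) : Prop :=
  ∃ x y : K, x ∉ Subgroup.zpowers u ∧ y ∉ Subgroup.zpowers u ∧ x⁻¹ * y ∉ Subgroup.zpowers u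

theorem sq_mem_zpowers_of_not_hasThreeCosets (h : ¬ HasThreeCosets u) (x : K) :
    x ^ 2 ∈ Subgroup.zpowers u := by
  by_cases hx : x ∈ Subgroup.zpowers u
  · exact pow_mem hx 2
  · by_contra hx2
    refine h ⟨x⁻¹, x, by rwa [inv_mem_iff], hx, ?_⟩
    rwa [inv_inv, ← sq]

theorem commute_sq_of_not_hasThreeCosets (h : ¬ HasThreeCosets u) (x y : K) :
    x ^ 2 * y ^ 2 = y ^ 2 * x ^ 2 := by
  obtain ⟨k, hk⟩ := sq_mem_zpowers_of_not_hasThreeCosets h x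
  obtain ⟨l, hl⟩ := sq_mem_zpowers_of_not_hasThreeCosets h y
  simp only at hk hl
  rw [← hk, ← hl, ← zpow_add, ← zpow_add, add_comm]

theorem eq_one_of_mem_zpowers_of_isOfFinOrder (hu : ¬ IsOfFinOrder u) {x : K}
    (hx : x ∈ Subgroup.zpowers u) (hfin : IsOfFinOrder x) : x = 1 := by
  obtain ⟨k, rfl⟩ := hx
  by_contra hne
  have hk : k ≠ 0 := by
    rintro rfl
    exact hne (zpow_zero u)
  obtain ⟨n, hn, hpow⟩ := isOfFinOrder_iff_pow_eq_one.1 hfin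
  refine hu (isOfFinOrder_iff_zpow_eq_one.2 ⟨k * n, mul_ne_zero hk (by positivity), ?_⟩)
  rw [zpow_mul, zpow_natCast]
  exact hpow

theorem zpow_left_injective_of_not_isOfFinOrder (hu : ¬ IsOfFinOrder u) {k l : ℤ}
    (h : u ^ k = u ^ l) : k = l :=
  injective_zpow_iff_not_isOfFinOrder.2 hu h

/-- If two involutions `a` and `b` generate a group in which `⟨u⟩` is an infinite subgroup with at
most two cosets, then `u` is `ab` or its inverse. -/
theorem eq_mul_or_eq_mul_of_involutions (hu : ¬ IsOfFinOrder u) (h : ¬ HasThreeCosets u) {a b : K}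
    (ha : a ^ 2 = 1) (hb : b ^ 2 = 1) (ha1 : a ≠ 1) (hb1 : b ≠ 1)
    (hab : Subgroup.closure {a, b} = ⊤) : u = a * b ∨ u = b * a := by
  have ha' : a⁻¹ = a := inv_eq_of_mul_eq_one_left (by rw [← sq, ha])
  have hb' : b⁻¹ = b := inv_eq_of_mul_eq_one_left (by rw [← sq, hb])
  have notin : ∀ x : K, x ^ 2 = 1 → x ≠ 1 → x ∉ Subgroup.zpowers u := fun x hx hx1 hmem =>
    hx1 (eq_one_of_mem_zpowers_of_isOfFinOrder hu hmem
      (isOfFinOrder_iff_pow_eq_one.2 ⟨2, by norm_num, hx⟩))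
  have habu : a * b ∈ Subgroup.zpowers u := by
    by_contra hmem
    exact h ⟨a, b, notin a ha ha1, notin b hb hb1, by rwa [ha']⟩
  have hconj : ∀ g ∈ ({a, b} : Set K), g * (a * b) * g⁻¹ = a * b ∨ g * (a * b) * g⁻¹ = (a * b)⁻¹ := by
    rintro g (rfl | rfl) <;> right
    · exact (conj_mul_of_involutions ha hb).1
    · exact (conj_mul_of_involutions ha hb).2
  have hnormal := zpowers_normal_of_generators hab hconj
  have htop : Subgroup.zpowers (a * b) ⊔ Subgroup.zpowers a = ⊤ := by
    rw [eq_top_iff, ← hab, Subgroup.closure_le]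
    rintro g (rfl | rfl)
    · exact Subgroup.mem_sup_right (Subgroup.mem_zpowers _)
    · have hmem : a * (a * g) ∈ Subgroup.zpowers (a * g) ⊔ Subgroup.zpowers a :=
        mul_mem (Subgroup.mem_sup_right (Subgroup.mem_zpowers _))
          (Subgroup.mem_sup_left (Subgroup.mem_zpowers _))
      rwa [← mul_assoc, ← sq, ha, one_mul] at hmem
  have hu_mem : u ∈ Subgroup.zpowers (a * b) := by
    obtain ⟨v, hv, w, ⟨m, rfl⟩, rfl⟩ := Subgroup.mem_sup_of_normal_left.1 (htop ▸ Subgroup.mem_top u)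
    rcases Int.even_or_odd' m with ⟨n, rfl | rfl⟩
    · have : a ^ (2 * n) = 1 := by rw [zpow_mul, zpow_ofNat, ha, one_zpow]
      simpa [this] using hv
    · exfalso
      have hm : a ^ (2 * n + 1) = a := by
        rw [zpow_add, zpow_mul, zpow_ofNat, ha, one_zpow, one_mul, zpow_one]
      obtain ⟨l, rfl⟩ := hv
      refine hu (isOfFinOrder_iff_pow_eq_one.2 ⟨2, by norm_num, ?_⟩)
      simp only
      have e : a * (a * b) ^ l * a⁻¹ = ((a * b) ^ l)⁻¹ := by
        rw [← conj_zpow, ← inv_zpow, (conj_mul_of_involutions ha hb).1]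
      rw [hm, sq]
      calc (a * b) ^ l * a * ((a * b) ^ l * a) = (a * b) ^ l * (a * (a * b) ^ l * a⁻¹) * a ^ 2 := by
            group
        _ = 1 := by rw [e, ha]; group
  obtain ⟨k, hk⟩ := habu
  obtain ⟨l, hl⟩ := hu_mem
  simp only at hk hl
  have hkl : u ^ (k * l) = u ^ (1 : ℤ) := by rw [zpow_mul, hk, hl, zpow_one]
  have hkl1 := zpow_left_injective_of_not_isOfFinOrder hu hkl
  rcases Int.eq_one_or_neg_one_of_mul_eq_one' hkl1 with ⟨-, rfl⟩ | ⟨-, rfl⟩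
  · left
    rw [← hl, zpow_one]
  · right
    rw [← hl, zpow_neg_one, mul_inv_rev, ha', hb']

end SmallIndex

section CyclicFactorsSmallIndex

variable {ι : Type*} [DecidableEq ι] {e : ι → ℕ} {P : ι → Prop}

theorem dvd_of_pow_of_eq_one {i : ι} (hi : P i) {n : ℕ}
    (h : (PresentedGroup.of i : PresentedGroup (cyclicRels e P)) ^ n = 1) : e i ∣ n := by
  obtain ⟨F, hF, -⟩ := exists_hom_of_cyclicRels (e := e) (P := P)
    (fun k => if k = i then Multiplicative.ofAdd (1 : ZMod (e i)) else 1) (by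
      intro k _
      by_cases hk : k = i
      · subst hk
        rw [if_pos rfl, ← ofAdd_nsmul]
        simp
      · simp [hk])
  have := congrArg F h
  rw [map_pow, map_one, hF i hi, if_pos rfl, ← ofAdd_nsmul, ofAdd_eq_one] at this
  rw [← ZMod.natCast_eq_zero_iff]
  simpa using this

/-- A free product of cyclic groups in which some infinite cyclic subgroup has at most two cosets
is infinite cyclic or infinite dihedral. -/
theorem classification_of_not_hasThreeCosets (he : ∀ i, e i = 0 ∨ 2 ≤ e i)
    {u : PresentedGroup (cyclicRels e P)} (hu : ¬ IsOfFinOrder u) (h : ¬ HasThreeCosets u) :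
    (∃ i, (∀ k, P k ↔ k = i) ∧ e i = 0) ∨
      ∃ i j, i ≠ j ∧ (∀ k, P k ↔ k = i ∨ k = j) ∧ e i = 2 ∧ e j = 2 ∧
        u = PresentedGroup.of i * PresentedGroup.of j := by
  have he2 : ∀ i, P i → e i = 0 ∨ e i = 2 := by
    intro i hi
    refine or_iff_not_imp_left.2 fun h0 => ?_
    have h2 : 2 ≤ e i := (he i).resolve_left h0
    have hfin : IsOfFinOrder ((PresentedGroup.of i : PresentedGroup (cyclicRels e P)) ^ 2) :=
      IsOfFinOrder.pow (isOfFinOrder_iff_pow_eq_one.2 ⟨e i, by omega, cyclicRels_of_pow hi⟩)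
    have hone := eq_one_of_mem_zpowers_of_isOfFinOrder hu
      (sq_mem_zpowers_of_not_hasThreeCosets h _) hfin
    have := Nat.le_of_dvd (by norm_num) (dvd_of_pow_of_eq_one hi hone)
    omega
  have hcomm : ∀ {T : Type} [Group T] (f : ι → T), (∀ i, P i → f i ^ e i = 1) → ∀ i j k,
      P i → P j → P k → f i ^ 2 * (f i * f j) ^ 2 = (f i * f j) ^ 2 * f i ^ 2 ∧
        (f i * f j) ^ 2 * (f j * f k) ^ 2 = (f j * f k) ^ 2 * (f i * f j) ^ 2 := by
    intro T _ f hf i j k hi hj hk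
    obtain ⟨F, hF, -⟩ := exists_hom_of_cyclicRels f hf
    have h1 := congrArg F (commute_sq_of_not_hasThreeCosets h (.of i) (.of i * .of j))
    have h2 := congrArg F (commute_sq_of_not_hasThreeCosets h (.of i * .of j) (.of j * .of k))
    simp only [map_mul, map_pow, hF i hi, hF j hj, hF k hk] at h1 h2
    exact ⟨h1, h2⟩
  have hpair : ∀ i j, P i → P j → i ≠ j → e i = 2 := by
    intro i j hi hj hij
    refine (he2 i hi).resolve_left fun h0 => ?_
    have := (hcomm (T := Equiv.Perm (Fin 4))
      (fun k => if k = i then finRotate 4 else if k = j then Equiv.swap 0 1 else 1) (by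
        intro k hk
        by_cases hki : k = i
        · subst hki
          rw [h0, pow_zero]
        · by_cases hkj : k = j
          · rw [if_neg hki, if_pos hkj]
            rcases he2 k hk with h | h <;> rw [h]
            · exact pow_zero _
            · decide
          · simp [hki, hkj]) i j j hi hj hj).1
    simp only [if_true, if_neg hij.symm] at this
    revert this
    decide
  have htriple : ∀ i j k, P i → P j → P k → i ≠ j → i ≠ k → j ≠ k → False := by
    intro i j k hi hj hk hij hik hjk
    have := (hcomm (T := Equiv.Perm (Fin 4))
      (fun l => if l = i then Equiv.swap 0 1 else if l = j then Equiv.swap 1 2 else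
        if l = k then Equiv.swap 2 3 else 1) (by
        intro l hl
        by_cases hli : l = i
        · simp only [if_pos hli]
          rw [hli, hpair i j hi hj hij]
          decide
        by_cases hlj : l = j
        · simp only [if_neg hli, if_pos hlj]
          rw [hlj, hpair j i hj hi hij.symm]
          decide
        by_cases hlk : l = k
        · simp only [if_neg hli, if_neg hlj, if_pos hlk]
          rw [hlk, hpair k i hk hi hik.symm]
          decide
        · simp [hli, hlj, hlk]) i j k hi hj hk).2
    simp only [if_true, if_neg hij.symm, if_neg hik.symm, if_neg hjk.symm] at this
    revert this
    decide
  have hgen : ∀ S : Set (PresentedGroup (cyclicRels e P)), (∀ i, P i → PresentedGroup.of i ∈ S) →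
      Subgroup.closure S = ⊤ := by
    intro S hS
    rw [eq_top_iff]
    intro x _
    refine PresentedGroup.generated_by _ _ (fun j => ?_) x
    by_cases hj : P j
    · exact Subgroup.subset_closure (hS j hj)
    · rw [cyclicRels_of_eq_one hj]
      exact one_mem _
  obtain ⟨i, hi⟩ : ∃ i, P i := by
    by_contra! hP
    have htop := hgen ∅ fun i hi => absurd hi (hP i)
    rw [Subgroup.closure_empty] at htop
    have : u = 1 := Subgroup.mem_bot.1 (htop ▸ Subgroup.mem_top u)
    exact hu (this ▸ IsOfFinOrder.one)
  by_cases hex : ∃ j, P j ∧ j ≠ i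
  · right
    obtain ⟨j, hj, hji⟩ := hex
    have hP : ∀ k, P k ↔ k = i ∨ k = j := by
      intro k
      constructor
      · intro hk
        by_contra! hne
        exact htriple i j k hi hj hk hji.symm hne.1.symm hne.2.symm
      · rintro (rfl | rfl) <;> assumption
    have hei := hpair i j hi hj hji.symm
    have hej := hpair j i hj hi hji
    have hne : ∀ k, P k → e k = 2 → (PresentedGroup.of k : PresentedGroup (cyclicRels e P)) ≠ 1 := by
      intro k hk hek h1
      have := Nat.dvd_one.1 (dvd_of_pow_of_eq_one hk ((pow_one _).trans h1))
      omega
    have hsq : ∀ k, P k → e k = 2 →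
        (PresentedGroup.of k : PresentedGroup (cyclicRels e P)) ^ 2 = 1 := fun k hk hek => by
      rw [← hek]
      exact cyclicRels_of_pow hk
    rcases eq_mul_or_eq_mul_of_involutions hu h (hsq i hi hei) (hsq j hj hej) (hne i hi hei)
      (hne j hj hej) (hgen _ (fun k hk => by rcases (hP k).1 hk with rfl | rfl <;> simp))
      with hu' | hu'
    · exact ⟨i, j, hji.symm, hP, hei, hej, hu'⟩
    · exact ⟨j, i, hji, fun k => (hP k).trans or_comm, hej, hei, hu'⟩
  · left
    have hP : ∀ k, P k ↔ k = i := by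
      intro k
      refine ⟨fun hk => by_contra fun hne => hex ⟨k, hk, hne⟩, ?_⟩
      rintro rfl
      exact hi
    refine ⟨i, hP, (he2 i hi).resolve_right fun h2 => hu ?_⟩
    have htop := hgen {PresentedGroup.of i} fun k hk => by rw [(hP k).1 hk]; rfl
    rw [← Subgroup.zpowers_eq_closure] at htop
    obtain ⟨k, hk⟩ : u ∈ Subgroup.zpowers (PresentedGroup.of i) := htop ▸ Subgroup.mem_top u
    rw [← hk]
    exact IsOfFinOrder.zpow (isOfFinOrder_iff_pow_eq_one.2 ⟨e i, by omega, cyclicRels_of_pow hi⟩)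

/-- The possible positions of `⟨U⟩` in a factor of a group of `F`-type: it is a proper subgroup, and
either it has at least three cosets, or the factor is `⟨a⟩` with `U = a²`, or the factor is
`⟨a, b ∣ a² = b² = 1⟩` with `U = ab`. -/
theorem factor_trichotomy (he : ∀ i, e i = 0 ∨ 2 ≤ e i) {U : FreeGroup ι}
    (hu : ¬ IsOfFinOrder (PresentedGroup.mk (cyclicRels e P) U))
    (hpow : ∀ i, (∀ k, P k ↔ k = i) → ∃ m, 2 ≤ m ∧ U = FreeGroup.of i ^ m) :
    (∃ z, z ∉ Subgroup.zpowers (PresentedGroup.mk (cyclicRels e P) U)) ∧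
      (HasThreeCosets (PresentedGroup.mk (cyclicRels e P) U) ∨
        (∃ i, (∀ k, P k ↔ k = i) ∧ e i = 0 ∧ U = FreeGroup.of i ^ 2) ∨
        ∃ i j, i ≠ j ∧ (∀ k, P k ↔ k = i ∨ k = j) ∧ e i = 2 ∧ e j = 2 ∧
          PresentedGroup.mk (cyclicRels e P) U = PresentedGroup.of i * PresentedGroup.of j) := by
  by_cases h : HasThreeCosets (PresentedGroup.mk (cyclicRels e P) U)
  · obtain ⟨x, y, hx, hrest⟩ := h
    exact ⟨⟨x, hx⟩, Or.inl ⟨x, y, hx, hrest⟩⟩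
  rcases classification_of_not_hasThreeCosets he hu h with ⟨i, hP, hei⟩ | ⟨i, j, hij, hP, hei, hej, hU⟩
  · obtain ⟨m, hm, rfl⟩ := hpow i hP
    have hmk : PresentedGroup.mk (cyclicRels e P) (FreeGroup.of i ^ m) =
        PresentedGroup.of i ^ m := map_pow _ _ _
    have hinf : ¬ IsOfFinOrder (PresentedGroup.of i : PresentedGroup (cyclicRels e P)) :=
      fun hfin => hu (hmk ▸ hfin.pow)
    have hdvd : ∀ n : ℕ, (PresentedGroup.of i : PresentedGroup (cyclicRels e P)) ^ n ∈
        Subgroup.zpowers (PresentedGroup.mk (cyclicRels e P) (FreeGroup.of i ^ m)) → m ∣ n := by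
      rintro n ⟨k, hk⟩
      simp only [hmk] at hk
      rw [← zpow_natCast, ← zpow_natCast, ← zpow_mul] at hk
      have := zpow_left_injective_of_not_isOfFinOrder hinf hk
      exact Int.natCast_dvd_natCast.1 ⟨k, this.symm⟩
    refine ⟨⟨PresentedGroup.of i, fun hmem => ?_⟩, Or.inr (Or.inl ⟨i, hP, hei, ?_⟩)⟩
    · have := Nat.le_of_dvd one_pos (hdvd 1 (by rwa [pow_one]))
      omega
    · have := Nat.le_of_dvd two_pos (hdvd 2 (sq_mem_zpowers_of_not_hasThreeCosets h _))
      rw [show m = 2 by omega]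
  · refine ⟨⟨PresentedGroup.of i, fun hmem => ?_⟩, Or.inr (Or.inr ⟨i, j, hij, hP, hei, hej, hU⟩)⟩
    have hi : P i := (hP i).2 (Or.inl rfl)
    have h1 := eq_one_of_mem_zpowers_of_isOfFinOrder hu hmem
      (isOfFinOrder_iff_pow_eq_one.2 ⟨e i, by omega, cyclicRels_of_pow hi⟩)
    have := Nat.dvd_one.1 (dvd_of_pow_of_eq_one hi ((pow_one _).trans h1))
    omega

end CyclicFactorsSmallIndex

section AmalgamPresentation

variable {ι : Type} {e : ι → ℕ} {W : Bool → FreeGroup ι}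

/-- Relators of the amalgam of two free products of cyclics, with `W false` identified with the
inverse of `W true`. -/
def amalgRels (e : ι → ℕ) (W : Bool → FreeGroup ι) : Set (FreeGroup ι) :=
  {w | ∃ i, w = FreeGroup.of i ^ e i} ∪ {W false * W true}

theorem lift_presentedGroup_of {κ : Type*} (R : Set (FreeGroup κ)) :
    FreeGroup.lift (PresentedGroup.of : κ → PresentedGroup R) = PresentedGroup.mk R := by
  ext i
  rw [FreeGroup.lift_apply_of]
  rfl

theorem amalgRels_of_pow (i : ι) :
    (PresentedGroup.of i : PresentedGroup (amalgRels e W)) ^ e i = 1 := by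
  rw [PresentedGroup.of, ← map_pow]
  exact PresentedGroup.one_of_mem (Or.inl ⟨i, rfl⟩)

theorem amalgRels_lift_mul_lift {b b' : Bool} (hb : b ≠ b') :
    FreeGroup.lift (PresentedGroup.of : ι → PresentedGroup (amalgRels e W)) (W b) *
      FreeGroup.lift PresentedGroup.of (W b') = 1 := by
  have h : PresentedGroup.mk (amalgRels e W) (W false) * PresentedGroup.mk _ (W true) = 1 := by
    rw [← map_mul]
    exact PresentedGroup.one_of_mem (Or.inr rfl)
  rw [lift_presentedGroup_of]
  cases b <;> cases b'
  · exact absurd rfl hb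
  · exact h
  · exact mul_eq_one_comm.1 h
  · exact absurd rfl hb

theorem exists_hom_of_amalgRels {T : Type*} [Group T] (f : ι → T) (hf : ∀ i, f i ^ e i = 1)
    {b b' : Bool} (hb : b ≠ b') (h : FreeGroup.lift f (W b) * FreeGroup.lift f (W b') = 1) :
    ∃ F : PresentedGroup (amalgRels e W) →* T, (∀ i, F (.of i) = f i) ∧
      ∀ w, F (PresentedGroup.mk _ w) = FreeGroup.lift f w := by
  have hrel : ∀ r ∈ amalgRels e W, FreeGroup.lift f r = 1 := by
    rintro r (⟨i, rfl⟩ | rfl)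
    · simp [hf i]
    · rw [map_mul]
      cases b <;> cases b'
      · exact absurd rfl hb
      · exact h
      · exact mul_eq_one_comm.1 h
      · exact absurd rfl hb
  exact ⟨PresentedGroup.toGroup hrel, fun i => PresentedGroup.toGroup.of hrel, fun w => rfl⟩

variable [DecidableEq ι] {side : ι → Bool}

open Monoid in
/-- If `⟨W b⟩` has at least three cosets in its factor and `⟨W b'⟩` is proper in the other one, then
the amalgam contains a free subgroup of rank two. -/
theorem exists_injective_of_hasThreeCosets (hW : ∀ b, ∀ x ∈ (W b).toWord, side x.1 = b)
    (hinf : ∀ b, ¬ IsOfFinOrder (PresentedGroup.mk (cyclicRels e (side · = b)) (W b)))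
    {b b' : Bool} (hb : b ≠ b')
    (h3 : HasThreeCosets (PresentedGroup.mk (cyclicRels e (side · = b)) (W b)))
    (hz : ∃ z, z ∉ Subgroup.zpowers (PresentedGroup.mk (cyclicRels e (side · = b')) (W b'))) :
    ∃ f : FreeGroup (Fin 2) →* PresentedGroup (amalgRels e W), Function.Injective f := by
  let K : Bool → Type := fun b => PresentedGroup (cyclicRels e (side · = b))
  let u : ∀ b, K b := fun b => PresentedGroup.mk _ (W b)
  let ε : Bool → ℤ := fun b => if b then 1 else -1
  have hε : ∀ b, ε b = 1 ∨ ε b = -1 := fun b => by cases b <;> simp [ε]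
  let φ : ∀ b, Multiplicative ℤ →* K b := fun b => zpowersHom _ (u b ^ ε b)
  have hφa : ∀ b n, φ b n = (u b ^ ε b) ^ n.toAdd := fun b n => rfl
  have hφ : ∀ b, Function.Injective (φ b) := by
    intro b m n hmn
    rw [hφa, hφa, ← zpow_mul, ← zpow_mul] at hmn
    have := zpow_left_injective_of_not_isOfFinOrder (hinf b) hmn
    rcases hε b with h | h <;> rw [h] at this
    · exact Multiplicative.toAdd.injective (by omega)
    · exact Multiplicative.toAdd.injective (by omega)
  have hrange : ∀ b, (φ b).range = Subgroup.zpowers (u b) := by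
    intro b
    have : (φ b).range = Subgroup.zpowers (u b ^ ε b) := by
      ext x
      exact ⟨fun ⟨n, hn⟩ => ⟨n.toAdd, hn⟩, fun ⟨n, hn⟩ => ⟨Multiplicative.ofAdd n, hn⟩⟩
    rw [this]
    rcases hε b with h | h <;> rw [h]
    · rw [zpow_one]
    · rw [zpow_neg_one, Subgroup.zpowers_inv]
  obtain ⟨x, y, hx, hy, hxy⟩ := h3
  obtain ⟨z, hz⟩ := hz
  obtain ⟨a, ha⟩ := exists_injective_lift_pushoutI φ hφ hb (x := x) (y := y) (z := z)
    (by rwa [hrange]) (by rwa [hrange]) (by rwa [hrange]) (by rwa [hrange])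
  let g : ι → PushoutI φ := fun i => PushoutI.of (side i) (PresentedGroup.of i)
  have hside : ∀ b i, side i = b → g i = PushoutI.of b (PresentedGroup.of i : K b) := by
    rintro b i rfl
    rfl
  have hlift : ∀ b, FreeGroup.lift g (W b) = PushoutI.of b (u b) := by
    intro b
    rw [lift_eq_of_agree_on_letters (g := fun i => PushoutI.of b (PresentedGroup.of i : K b))
      fun x hx => hside b x.1 (hW b x hx)]
    change _ = ((PushoutI.of (φ := φ) b).comp
      (PresentedGroup.mk (cyclicRels e (side · = b)) : FreeGroup ι →* K b)) (W b)
    congr 1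
    ext i
    rw [FreeGroup.lift_apply_of]
    rfl
  obtain ⟨F, hF, -⟩ := exists_hom_of_amalgRels (e := e) (W := W) g
    (fun i => by
      rw [← map_pow, cyclicRels_of_pow (P := (side · = side i)) rfl, map_one])
    (b := false) (b' := true) (by decide) (by
      have h1 : φ false (Multiplicative.ofAdd 1) = (u false)⁻¹ := by simp [hφa, ε]
      have h2 : φ true (Multiplicative.ofAdd 1) = u true := by simp [hφa, ε]
      rw [hlift, hlift, ← inv_inv (u false), ← h1, ← h2, map_inv, PushoutI.of_apply_eq_base,
        PushoutI.of_apply_eq_base, inv_mul_cancel])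
  have hsurj : ∀ b (k : K b), PushoutI.of b k ∈ F.range := by
    intro b k
    refine PresentedGroup.generated_by _ (F.range.comap (PushoutI.of (φ := φ) b : K b →* PushoutI φ)) (fun i => ?_) k
    by_cases hi : side i = b
    · exact ⟨.of i, (hF i).trans (hside b i hi)⟩
    · have h1 : (PresentedGroup.of i : K b) = 1 := cyclicRels_of_eq_one hi
      exact h1 ▸ one_mem (F.range.comap (PushoutI.of (φ := φ) b : K b →* PushoutI φ))
  have hsurj' : Function.Surjective F := by
    intro k
    induction k using PushoutI.induction_on with
    | of b k => exact hsurj b k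
    | base h =>
      rw [← PushoutI.of_apply_eq_base φ true]
      exact hsurj true _
    | mul k l hk hl => exact F.range.mul_mem hk hl
  choose s hs using hsurj'
  refine ⟨FreeGroup.lift (s ∘ a), ?_⟩
  have hcomp : F.comp (FreeGroup.lift (s ∘ a)) = FreeGroup.lift a := by
    ext i
    simp [hs]
  refine Function.Injective.of_comp (f := F) ?_
  rw [← MonoidHom.coe_comp, hcomp]
  exact ha

theorem nonempty_mulEquiv_of_generators {α β : Type*} {R : Set (FreeGroup α)} {S : Set (FreeGroup β)}
    (F : PresentedGroup R →* PresentedGroup S) (F' : PresentedGroup S →* PresentedGroup R)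
    (h : ∀ a, F' (F (.of a)) = .of a) (h' : ∀ b, F (F' (.of b)) = .of b) :
    Nonempty (PresentedGroup R ≃* PresentedGroup S) :=
  ⟨MonoidHom.toMulEquiv F F' (PresentedGroup.ext h) (PresentedGroup.ext h')⟩

theorem relsH1_eq :
    (PresentedGroup.of 0 ^ 2 * PresentedGroup.of 1 ^ 2 : PresentedGroup relsH1) = 1 :=
  PresentedGroup.one_of_mem (Set.mem_singleton _)

theorem relsH2_eq :
    (PresentedGroup.of 0 ^ 2 : PresentedGroup relsH2) = 1 ∧
      (PresentedGroup.of 1 ^ 2 : PresentedGroup relsH2) = 1 ∧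
      (PresentedGroup.of 0 * PresentedGroup.of 1 * PresentedGroup.of 2 ^ 2 :
        PresentedGroup relsH2) = 1 :=
  ⟨PresentedGroup.one_of_mem (by simp [relsH2]), PresentedGroup.one_of_mem (by simp [relsH2]),
    PresentedGroup.one_of_mem (by simp [relsH2])⟩

theorem relsH3_eq :
    (∀ i, (PresentedGroup.of i ^ 2 : PresentedGroup relsH3) = 1) ∧
      (PresentedGroup.of 0 * PresentedGroup.of 1 * PresentedGroup.of 2 * PresentedGroup.of 3 :
        PresentedGroup relsH3) = 1 := by
  refine ⟨fun i => PresentedGroup.one_of_mem ?_, PresentedGroup.one_of_mem (by simp [relsH3])⟩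
  fin_cases i <;> simp [relsH3]

theorem nonempty_mulEquiv_relsH1 {i j : ι} (hij : i ≠ j) (hι : ∀ k, k = i ∨ k = j)
    (hi : e i = 0) (hj : e j = 0) (hU : W false = FreeGroup.of i ^ 2)
    (hV : W true = FreeGroup.of j ^ 2) :
    Nonempty (PresentedGroup (amalgRels e W) ≃* PresentedGroup relsH1) := by
  let f : ι → PresentedGroup relsH1 := fun k => if k = i then .of 0 else .of 1
  have fi : f i = .of 0 := if_pos rfl
  have fj : f j = .of 1 := if_neg hij.symm
  obtain ⟨F, hF, -⟩ := exists_hom_of_amalgRels (e := e) (W := W) f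
    (by
      intro k
      rcases hι k with rfl | rfl
      · rw [hi, pow_zero]
      · rw [hj, pow_zero])
    (b := false) (b' := true) (by decide) (by
      rw [hU, hV, map_pow, map_pow, FreeGroup.lift_apply_of, FreeGroup.lift_apply_of, fi, fj]
      exact relsH1_eq)
  let g : Fin 2 → PresentedGroup (amalgRels e W) := ![.of i, .of j]
  have hg : ∀ r ∈ relsH1, FreeGroup.lift g r = 1 := by
    rintro r rfl
    have := amalgRels_lift_mul_lift (e := e) (W := W) (b := false) (b' := true) (by decide)
    simpa [hU, hV, g] using this
  refine nonempty_mulEquiv_of_generators F (PresentedGroup.toGroup hg) ?_ ?_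
  · intro k
    rcases hι k with rfl | rfl
    · rw [hF, fi, PresentedGroup.toGroup.of]; rfl
    · rw [hF, fj, PresentedGroup.toGroup.of]; rfl
  · intro k
    rw [PresentedGroup.toGroup.of]
    fin_cases k
    · exact (hF i).trans fi
    · exact (hF j).trans fj

theorem nonempty_mulEquiv_relsH2 (hW : ∀ b, ∀ x ∈ (W b).toWord, side x.1 = b)
    {b b' : Bool} (hb : b ≠ b') {i j l : ι} (hij : i ≠ j)
    (hP : ∀ k, side k = b ↔ k = i ∨ k = j) (hP' : ∀ k, side k = b' ↔ k = l)
    (hi : e i = 2) (hj : e j = 2) (hl : e l = 0)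
    (hU : PresentedGroup.mk (cyclicRels e (side · = b)) (W b) =
      PresentedGroup.of i * PresentedGroup.of j)
    (hV : W b' = FreeGroup.of l ^ 2) :
    Nonempty (PresentedGroup (amalgRels e W) ≃* PresentedGroup relsH2) := by
  have hsi : side i = b := (hP i).2 (Or.inl rfl)
  have hsj : side j = b := (hP j).2 (Or.inr rfl)
  have hsl : side l = b' := (hP' l).2 rfl
  have hbool : ∀ b b' c : Bool, b ≠ b' → ¬ c = b → c = b' := by decide
  have hι : ∀ k, k = i ∨ k = j ∨ k = l := by
    intro k
    by_cases hk : side k = b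
    · have := (hP k).1 hk
      tauto
    · have := (hP' k).1 (hbool _ _ _ hb hk)
      tauto
  have hli : l ≠ i := fun h => hb (by rw [← hsi, ← hsl, h])
  have hlj : l ≠ j := fun h => hb (by rw [← hsj, ← hsl, h])
  have hlift : ∀ {T : Type} [Group T] (f : ι → T), (∀ k, f k ^ e k = 1) →
      FreeGroup.lift f (W b) * FreeGroup.lift f (W b') = f i * f j * f l ^ 2 := by
    intro T _ f hf
    rw [lift_eq_mul_of_mk_eq f (fun k _ => hf k) (hW b) hsi hsj hU, hV, map_pow,
      FreeGroup.lift_apply_of]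
  obtain ⟨h0, h1, h2⟩ := relsH2_eq
  let f : ι → PresentedGroup relsH2 := fun k => if k = i then .of 0 else if k = j then .of 1 else .of 2
  have fi : f i = .of 0 := if_pos rfl
  have fj : f j = .of 1 := (if_neg hij.symm).trans (if_pos rfl)
  have fl : f l = .of 2 := (if_neg hli).trans (if_neg hlj)
  have hf : ∀ k, f k ^ e k = 1 := by
    intro k
    rcases hι k with rfl | rfl | rfl
    · rw [hi, fi, h0]
    · rw [hj, fj, h1]
    · rw [hl, pow_zero]
  obtain ⟨F, hF, -⟩ := exists_hom_of_amalgRels (e := e) (W := W) f hf hb (by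
    rw [hlift f hf, fi, fj, fl, h2])
  let g : Fin 3 → PresentedGroup (amalgRels e W) := ![.of i, .of j, .of l]
  have hg : ∀ r ∈ relsH2, FreeGroup.lift g r = 1 := by
    rintro r (rfl | rfl | rfl)
    · rw [map_pow, FreeGroup.lift_apply_of, ← hi]
      exact amalgRels_of_pow i
    · rw [map_pow, FreeGroup.lift_apply_of, ← hj]
      exact amalgRels_of_pow j
    · have := amalgRels_lift_mul_lift (e := e) (W := W) hb
      rw [hlift _ amalgRels_of_pow] at this
      simpa [g] using this
  refine nonempty_mulEquiv_of_generators F (PresentedGroup.toGroup hg) ?_ ?_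
  · intro k
    rcases hι k with rfl | rfl | rfl
    · rw [hF, fi, PresentedGroup.toGroup.of]; rfl
    · rw [hF, fj, PresentedGroup.toGroup.of]; rfl
    · rw [hF, fl, PresentedGroup.toGroup.of]; rfl
  · intro k
    rw [PresentedGroup.toGroup.of]
    fin_cases k
    · exact (hF i).trans fi
    · exact (hF j).trans fj
    · exact (hF l).trans fl

theorem nonempty_mulEquiv_relsH3 (hW : ∀ b, ∀ x ∈ (W b).toWord, side x.1 = b)
    {i j l m : ι} (hij : i ≠ j) (hlm : l ≠ m)
    (hP : ∀ k, side k = false ↔ k = i ∨ k = j) (hP' : ∀ k, side k = true ↔ k = l ∨ k = m)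
    (hi : e i = 2) (hj : e j = 2) (hl : e l = 2) (hm : e m = 2)
    (hU : PresentedGroup.mk (cyclicRels e (side · = false)) (W false) =
      PresentedGroup.of i * PresentedGroup.of j)
    (hV : PresentedGroup.mk (cyclicRels e (side · = true)) (W true) =
      PresentedGroup.of l * PresentedGroup.of m) :
    Nonempty (PresentedGroup (amalgRels e W) ≃* PresentedGroup relsH3) := by
  have hsi : side i = false := (hP i).2 (Or.inl rfl)
  have hsj : side j = false := (hP j).2 (Or.inr rfl)
  have hsl : side l = true := (hP' l).2 (Or.inl rfl)
  have hsm : side m = true := (hP' m).2 (Or.inr rfl)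
  have hι : ∀ k, k = i ∨ k = j ∨ k = l ∨ k = m := by
    intro k
    cases hk : side k
    · have := (hP k).1 hk
      tauto
    · have := (hP' k).1 hk
      tauto
  have hne : ∀ {a b : ι}, side a = false → side b = true → b ≠ a := by
    rintro a _ ha hb rfl
    simp [ha] at hb
  have he : ∀ k, e k = 2 := by
    intro k
    rcases hι k with rfl | rfl | rfl | rfl <;> assumption
  have hlift : ∀ {T : Type} [Group T] (f : ι → T), (∀ k, f k ^ e k = 1) →
      FreeGroup.lift f (W false) * FreeGroup.lift f (W true) = f i * f j * f l * f m := by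
    intro T _ f hf
    rw [lift_eq_mul_of_mk_eq f (fun k _ => hf k) (hW false) hsi hsj hU,
      lift_eq_mul_of_mk_eq f (fun k _ => hf k) (hW true) hsl hsm hV, ← mul_assoc]
  obtain ⟨hsq, hprod⟩ := relsH3_eq
  let f : ι → PresentedGroup relsH3 := fun k =>
    if k = i then .of 0 else if k = j then .of 1 else if k = l then .of 2 else .of 3
  have fi : f i = .of 0 := if_pos rfl
  have fj : f j = .of 1 := (if_neg hij.symm).trans (if_pos rfl)
  have fl : f l = .of 2 :=
    (if_neg (hne hsi hsl)).trans ((if_neg (hne hsj hsl)).trans (if_pos rfl))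
  have fm : f m = .of 3 :=
    (if_neg (hne hsi hsm)).trans ((if_neg (hne hsj hsm)).trans (if_neg hlm.symm))
  have hf : ∀ k, f k ^ e k = 1 := by
    intro k
    rw [he k]
    rcases hι k with rfl | rfl | rfl | rfl
    · rw [fi, hsq]
    · rw [fj, hsq]
    · rw [fl, hsq]
    · rw [fm, hsq]
  obtain ⟨F, hF, -⟩ := exists_hom_of_amalgRels (e := e) (W := W) f hf
    (b := false) (b' := true) (by decide) (by
      rw [hlift f hf, fi, fj, fl, fm, hprod])
  let g : Fin 4 → PresentedGroup (amalgRels e W) := ![.of i, .of j, .of l, .of m]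
  have hg2 : ∀ k, FreeGroup.lift g (FreeGroup.of k ^ 2) = 1 := by
    intro k
    have : ∀ k, (PresentedGroup.of k : PresentedGroup (amalgRels e W)) ^ 2 = 1 := by
      intro k
      rw [← he k]
      exact amalgRels_of_pow k
    rw [map_pow, FreeGroup.lift_apply_of]
    fin_cases k <;> exact this _
  have hg : ∀ r ∈ relsH3, FreeGroup.lift g r = 1 := by
    rintro r (rfl | rfl | rfl | rfl | rfl)
    · exact hg2 _
    · exact hg2 _
    · exact hg2 _
    · exact hg2 _
    · have := amalgRels_lift_mul_lift (e := e) (W := W) (b := false) (b' := true) (by decide)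
      rw [hlift _ amalgRels_of_pow] at this
      simpa [g] using this
  refine nonempty_mulEquiv_of_generators F (PresentedGroup.toGroup hg) ?_ ?_
  · intro k
    rcases hι k with rfl | rfl | rfl | rfl
    · rw [hF, fi, PresentedGroup.toGroup.of]; rfl
    · rw [hF, fj, PresentedGroup.toGroup.of]; rfl
    · rw [hF, fl, PresentedGroup.toGroup.of]; rfl
    · rw [hF, fm, PresentedGroup.toGroup.of]; rfl
  · intro k
    rw [PresentedGroup.toGroup.of]
    fin_cases k
    · exact (hF i).trans fi
    · exact (hF j).trans fj
    · exact (hF l).trans fl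
    · exact (hF m).trans fm

/-- The alternative for an amalgam of two free products of cyclics along infinite cyclic subgroups
`⟨W false⟩` and `⟨W true⟩`. -/
theorem exists_injective_or_nonempty_mulEquiv (he : ∀ i, e i = 0 ∨ 2 ≤ e i)
    (hW : ∀ b, ∀ x ∈ (W b).toWord, side x.1 = b)
    (hinf : ∀ b, ¬ IsOfFinOrder (PresentedGroup.mk (cyclicRels e (side · = b)) (W b)))
    (hpow : ∀ b, ∀ i, (∀ k, side k = b ↔ k = i) → ∃ m, 2 ≤ m ∧ W b = FreeGroup.of i ^ m) :
    (∃ f : FreeGroup (Fin 2) →* PresentedGroup (amalgRels e W), Function.Injective f) ∨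
      (Nonempty (PresentedGroup (amalgRels e W) ≃* PresentedGroup relsH1) ∨
        Nonempty (PresentedGroup (amalgRels e W) ≃* PresentedGroup relsH2) ∨
        Nonempty (PresentedGroup (amalgRels e W) ≃* PresentedGroup relsH3)) := by
  obtain ⟨hz1, h1⟩ := factor_trichotomy he (hinf false) (hpow false)
  obtain ⟨hz2, h2⟩ := factor_trichotomy he (hinf true) (hpow true)
  have hft : false ≠ true := by decide
  rcases h1 with h1 | ⟨i, hP, hi, hUi⟩ | ⟨i, j, hij, hP, hi, hj, hUij⟩
  · exact Or.inl (exists_injective_of_hasThreeCosets hW hinf hft h1 hz2)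
  all_goals rcases h2 with h2 | ⟨l, hP', hl, hVl⟩ | ⟨l, m, hlm, hP', hl, hm, hVlm⟩
  · exact Or.inl (exists_injective_of_hasThreeCosets hW hinf hft.symm h2 hz1)
  · refine Or.inr (Or.inl (nonempty_mulEquiv_relsH1 (i := i) (j := l) ?_ ?_ hi hl hUi hVl))
    · rintro rfl
      exact hft (((hP i).2 rfl).symm.trans ((hP' i).2 rfl))
    · intro k
      cases hk : side k
      · exact Or.inl ((hP k).1 hk)
      · exact Or.inr ((hP' k).1 hk)
  · exact Or.inr (Or.inr (Or.inl
      (nonempty_mulEquiv_relsH2 hW hft.symm hlm hP' hP hl hm hi hVlm hUi)))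
  · exact Or.inl (exists_injective_of_hasThreeCosets hW hinf hft.symm h2 hz1)
  · exact Or.inr (Or.inr (Or.inl (nonempty_mulEquiv_relsH2 hW hft hij hP hP' hi hj hl hUij hVl)))
  · exact Or.inr (Or.inr (Or.inr
      (nonempty_mulEquiv_relsH3 hW hij hlm hP hP' hi hj hl hm hUij hVlm)))

end AmalgamPresentation

section Solvability

theorem isSolvable_relsH1 : Group.IsSolvable (PresentedGroup relsH1) := by
  let a : PresentedGroup relsH1 := .of 0
  let b : PresentedGroup relsH1 := .of 1
  have h : a ^ 2 * b ^ 2 = 1 := relsH1_eq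
  have hba : a ^ 2 = (b ^ 2)⁻¹ := eq_inv_of_mul_eq_one_left h
  refine isSolvable_of_cyclic_by_dihedral (PresentedGroup.closure_range_of relsH1)
    (z := a ^ 2) (s := a) (t := b) ?_ (Subgroup.mem_zpowers _) ?_ ?_
  · rintro _ ⟨k, rfl⟩
    left
    fin_cases k
    · change a * a ^ 2 * a⁻¹ = a ^ 2
      group
    · change b * a ^ 2 * b⁻¹ = a ^ 2
      rw [hba]
      group
  · rw [← inv_mem_iff, ← hba]
    exact Subgroup.mem_zpowers _
  · rintro _ ⟨k, rfl⟩
    fin_cases k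
    · left
      simp [a]
    · right
      simp [b]

theorem isSolvable_relsH2 : Group.IsSolvable (PresentedGroup relsH2) := by
  let a : PresentedGroup relsH2 := .of 0
  let b : PresentedGroup relsH2 := .of 1
  let c : PresentedGroup relsH2 := .of 2
  obtain ⟨ha, hb, h⟩ : a ^ 2 = 1 ∧ b ^ 2 = 1 ∧ a * b * c ^ 2 = 1 := relsH2_eq
  have hab : a * b = (c ^ 2)⁻¹ := eq_inv_of_mul_eq_one_left h
  refine isSolvable_of_cyclic_by_dihedral (PresentedGroup.closure_range_of relsH2)
    (z := a * b) (s := a) (t := c) ?_ ?_ ?_ ?_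
  · rintro _ ⟨k, rfl⟩
    fin_cases k
    · exact Or.inr (conj_mul_of_involutions ha hb).1
    · exact Or.inr (conj_mul_of_involutions ha hb).2
    · left
      change c * (a * b) * c⁻¹ = a * b
      rw [hab]
      group
  · rw [ha]
    exact one_mem _
  · rw [← inv_mem_iff, ← hab]
    exact Subgroup.mem_zpowers _
  · rintro _ ⟨k, rfl⟩
    fin_cases k
    · left
      simp [a]
    · left
      change a⁻¹ * b ∈ _
      rw [inv_eq_of_mul_eq_one_left ((sq a).symm.trans ha)]
      exact Subgroup.mem_zpowers _
    · right
      simp [c]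

theorem isSolvable_relsH3 : Group.IsSolvable (PresentedGroup relsH3) := by
  let a : PresentedGroup relsH3 := .of 0
  let b : PresentedGroup relsH3 := .of 1
  let c : PresentedGroup relsH3 := .of 2
  let d : PresentedGroup relsH3 := .of 3
  have hsq := relsH3_eq.1
  have ha : a ^ 2 = 1 := hsq 0
  have hb : b ^ 2 = 1 := hsq 1
  have hc : c ^ 2 = 1 := hsq 2
  have hd : d ^ 2 = 1 := hsq 3
  have h : a * b * c * d = 1 := relsH3_eq.2
  have hab : a * b = (c * d)⁻¹ := eq_inv_of_mul_eq_one_left (by rw [← mul_assoc, h])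
  refine isSolvable_of_cyclic_by_dihedral (PresentedGroup.closure_range_of relsH3)
    (z := a * b) (s := a) (t := c) ?_ ?_ ?_ ?_
  · rintro _ ⟨k, rfl⟩
    right
    fin_cases k
    · exact (conj_mul_of_involutions ha hb).1
    · exact (conj_mul_of_involutions ha hb).2
    · change c * (a * b) * c⁻¹ = (a * b)⁻¹
      rw [hab, ← conj_inv, (conj_mul_of_involutions hc hd).1]
    · change d * (a * b) * d⁻¹ = (a * b)⁻¹
      rw [hab, ← conj_inv, (conj_mul_of_involutions hc hd).2]
  · rw [ha]
    exact one_mem _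
  · rw [hc]
    exact one_mem _
  · rintro _ ⟨k, rfl⟩
    fin_cases k
    · left
      simp [a]
    · left
      change a⁻¹ * b ∈ _
      rw [inv_eq_of_mul_eq_one_left ((sq a).symm.trans ha)]
      exact Subgroup.mem_zpowers _
    · right
      simp [c]
    · right
      change c⁻¹ * d ∈ _
      rw [inv_eq_of_mul_eq_one_left ((sq c).symm.trans hc), ← inv_mem_iff, ← hab]
      exact Subgroup.mem_zpowers _

end Solvability

theorem eq_one_of_lt_iff_eq {n p : ℕ} (hp : 1 ≤ p) (hpn : p ≤ n - 1) {i : Fin n}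
    (hi : ∀ k : Fin n, (k : ℕ) < p ↔ k = i) : p = 1 ∧ (i : ℕ) = 0 := by
  have hn := i.isLt
  have h0 : 0 = (i : ℕ) := congrArg Fin.val ((hi ⟨0, by omega⟩).1 hp)
  refine ⟨?_, h0.symm⟩
  by_contra hne
  have h1 : 1 = (i : ℕ) :=
    congrArg Fin.val ((hi ⟨1, by omega⟩).1 (lt_of_le_of_ne hp (Ne.symm hne)))
  omega

theorem eq_sub_one_of_le_iff_eq {n p : ℕ} (hpn : p ≤ n - 1) {i : Fin n}
    (hi : ∀ k : Fin n, p ≤ (k : ℕ) ↔ k = i) : p = n - 1 ∧ (i : ℕ) = n - 1 := by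
  have hn := i.isLt
  have h0 : n - 1 = (i : ℕ) := congrArg Fin.val ((hi ⟨n - 1, by omega⟩).1 hpn)
  refine ⟨?_, h0.symm⟩
  have h1 : p = (i : ℕ) := congrArg Fin.val ((hi ⟨p, by omega⟩).1 le_rfl)
  omega

theorem FTypeBase.tits_alternative (D : FTypeBase) (hD : D.IsFType) :
    (∃ f : FreeGroup (Fin 2) →* D.Gp, Function.Injective f) ∨
      (Nonempty (D.Gp ≃* PresentedGroup relsH1) ∨ Nonempty (D.Gp ≃* PresentedGroup relsH2) ∨
        Nonempty (D.Gp ≃* PresentedGroup relsH3)) := by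
  obtain ⟨hn, he, hp1, hpn, hUl, hVl, -, -, hU, hV, hUp, hVp⟩ := hD
  let side : Fin D.n → Bool := fun i => decide (D.p ≤ (i : ℕ))
  let W : Bool → FreeGroup (Fin D.n) := fun b => if b then D.V else D.U
  have hW : ∀ b, ∀ x ∈ (W b).toWord, side x.1 = b := by
    rintro (_ | _) x hx
    · exact decide_eq_false (not_le.2 (hUl x hx))
    · exact decide_eq_true (hVl x hx)
  have hr1 : cyclicRels D.e (side · = false) = D.rels1 := by
    simp [cyclicRels, FTypeBase.rels1, side]
  have hr2 : cyclicRels D.e (side · = true) = D.rels2 := by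
    simp [cyclicRels, FTypeBase.rels2, side]
  have hinf : ∀ b, ¬ IsOfFinOrder (PresentedGroup.mk (cyclicRels D.e (side · = b)) (W b)) := by
    rintro (_ | _)
    · rw [hr1]
      exact hU
    · rw [hr2]
      exact hV
  have hpow : ∀ b, ∀ i, (∀ k, side k = b ↔ k = i) → ∃ m, 2 ≤ m ∧ W b = FreeGroup.of i ^ m := by
    rintro (_ | _) i hi
    · obtain ⟨hp, h0⟩ := eq_one_of_lt_iff_eq hp1 hpn (i := i) fun k => by
        rw [← hi k, decide_eq_false_iff_not, not_le]
      obtain ⟨j, m, hj, hm, hUm⟩ := hUp hp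
      have hji : j = i := Fin.ext (hj.trans h0.symm)
      exact ⟨m, hm, hji ▸ hUm⟩
    · obtain ⟨hp, h0⟩ := eq_sub_one_of_le_iff_eq hpn (i := i) fun k => by
        rw [← hi k, decide_eq_true_iff]
      obtain ⟨j, m, hj, hm, hVm⟩ := hVp hp
      have hji : j = i := Fin.ext (hj.trans h0.symm)
      exact ⟨m, hm, hji ▸ hVm⟩
  have hrels : D.rels = amalgRels D.e W := rfl
  have key := exists_injective_or_nonempty_mulEquiv he hW hinf hpow
  rw [← hrels] at key
  exact key

/-- A group of F-type either contains a free subgroup of rank `2`, or it is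
solvable and isomorphic to one of `H₁`, `H₂`, `H₃`. -/
theorem fType_tits_alternative (G : Type*) [Group G] (hG : IsFTypeGroup G) :
    (∃ f : FreeGroup (Fin 2) →* G, Function.Injective f) ∨
      (IsSolvable G ∧
        (Nonempty (G ≃* PresentedGroup relsH1) ∨ Nonempty (G ≃* PresentedGroup relsH2) ∨
          Nonempty (G ≃* PresentedGroup relsH3))) := by
  obtain ⟨D, hD, ⟨φ⟩⟩ := hG
  have solvable : ∀ {H : Type} [Group H], Group.IsSolvable H → (G ≃* H) → Group.IsSolvable G :=
    fun _ ψ => Group.isSolvable_of_isSolvable_injective (f := ψ.toMonoidHom) ψ.injective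
  rcases D.tits_alternative hD with ⟨f, hf⟩ | ⟨⟨ψ⟩⟩ | ⟨⟨ψ⟩⟩ | ⟨⟨ψ⟩⟩
  · exact Or.inl ⟨φ.symm.toMonoidHom.comp f, φ.symm.injective.comp hf⟩
  · exact Or.inr ⟨solvable isSolvable_relsH1 (φ.trans ψ), Or.inl ⟨φ.trans ψ⟩⟩
  · exact Or.inr ⟨solvable isSolvable_relsH2 (φ.trans ψ), Or.inr (Or.inl ⟨φ.trans ψ⟩)⟩
  · exact Or.inr ⟨solvable isSolvable_relsH3 (φ.trans ψ), Or.inr (Or.inr ⟨φ.trans ψ⟩)⟩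

end FPaper
end
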